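/- arXiv:1402.3833 — 8 statements merged into one kernel-verified Lean document; each statement's English description precedes it below -/
import Mathlib

section
/- Let 1 ≤ k ≤ d and let 0 ≤ s_1 < s_2 < … < s_k ≤ d−1 be integers. Define z = #{(j_2,…,j_k) ∈ {0,…,m−1}^{k−1} : g^{s_1} + g^{d·j_2 + s_2} + … + g^{d·j_k + s_k} = 0 in ZMod p} and, for each j ∈ {0,…,d−1}, μ_j = #{(j_2,…,j_k) ∈ {0,…,m−1}^{k−1} : g^{s_1} + g^{d·j_2 + s_2} + … + g^{d·j_k + s_k} ∈ C_j}. Then ∏_{i=1}^{k} η_{s_i} = m·z + ∑_{j=0}^{d−1} μ_j·η_j, and moreover z + ∑_{j=0}^{d−1} μ_j = m^{k−1}. -/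
/-- The coset `C_s = g^s · C₀` (as a subset of `ZMod p`) of the subgroup `C₀` of
d-th powers of units, for `s : ZMod d`. -/
def Cset (p d : ℕ) [NeZero p] (g : (ZMod p)ˣ) (s : ZMod d) : Finset (ZMod p) :=
  Finset.univ.filter fun x : ZMod p =>
    ∃ y : (ZMod p)ˣ, x = (g : ZMod p) ^ s.val * (y : ZMod p) ^ d

/-- The Gauss d-period `η_j = ∑_{x ∈ C_j} ζ^x`. -/
noncomputable def eta (p d : ℕ) [NeZero p] (g : (ZMod p)ˣ) (ζ : ℂ) (j : ZMod d) : ℂ :=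
  ∑ x ∈ Cset p d g j, ζ ^ x.val

theorem mem_Cset_iff {p d : ℕ} [Fact p.Prime] {g : (ZMod p)ˣ} {j : ℕ} (hj : j < d) {x : ZMod p} :
    x ∈ Cset p d g (j : ZMod d) ↔ ∃ y : (ZMod p)ˣ, x = (g : ZMod p) ^ j * (y : ZMod p) ^ d := by
  simp [Cset, ZMod.val_natCast_of_lt hj]

theorem zero_notMem_Cset {p d : ℕ} [Fact p.Prime] (g : (ZMod p)ˣ) (j : ZMod d) :
    (0 : ZMod p) ∉ Cset p d g j := by
  simp only [Cset, Finset.mem_filter, Finset.mem_univ, true_and, not_exists]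
  intro y h
  exact mul_ne_zero (pow_ne_zero _ g.ne_zero) (pow_ne_zero _ y.ne_zero) h.symm

theorem orderOf_eq_of_forall_pow {p : ℕ} [Fact p.Prime] {g : (ZMod p)ˣ}
    (hg : ∀ x : (ZMod p)ˣ, ∃ n : ℕ, g ^ n = x) : orderOf g = p - 1 := by
  rw [orderOf_eq_card_of_forall_mem_zpowers, Nat.card_eq_fintype_card, ZMod.card_units]
  intro x
  obtain ⟨n, rfl⟩ := hg x
  exact Subgroup.npow_mem_zpowers g n

/-- Every nonzero residue lies in exactly one of the cosets. -/
theorem existsUnique_mem_Cset {p d m : ℕ} [Fact p.Prime] (hd : 1 ≤ d) (hdm : p - 1 = d * m)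
    {g : (ZMod p)ˣ} (hg : ∀ x : (ZMod p)ˣ, ∃ n : ℕ, g ^ n = x) {x : ZMod p} (hx : x ≠ 0) :
    ∃! j : Fin d, x ∈ Cset p d g ((j : ℕ) : ZMod d) := by
  obtain ⟨n, hn⟩ := hg (Units.mk0 x hx)
  have hxn : x = (g : ZMod p) ^ n := by
    rw [← Units.val_pow_eq_pow_val, hn, Units.val_mk0]
  refine ⟨⟨n % d, Nat.mod_lt _ hd⟩, ?_, ?_⟩
  · refine (mem_Cset_iff (Nat.mod_lt _ hd)).2 ⟨g ^ (n / d), ?_⟩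
    rw [Units.val_pow_eq_pow_val, ← pow_mul, ← pow_add, hxn, mul_comm (n / d), Nat.mod_add_div]
  · intro j hj
    obtain ⟨y, hy⟩ := (mem_Cset_iff j.2).1 hj
    obtain ⟨l, rfl⟩ := hg y
    have h : g ^ n = g ^ (j + l * d) := by
      ext
      rw [Units.val_pow_eq_pow_val, Units.val_pow_eq_pow_val, ← hxn, hy,
        Units.val_pow_eq_pow_val, ← pow_mul, ← pow_add]
    rw [pow_eq_pow_iff_modEq, orderOf_eq_of_forall_pow hg, hdm] at h
    have h' : n % d = (j + l * d) % d := h.of_mul_right m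
    ext
    simp [h', Nat.mod_eq_of_lt j.2]

/-- The coset containing `x` is parametrised by `l ↦ x * g ^ (d * l)`. -/
theorem sum_mul_pow_eq_sum_Cset {M : Type*} [AddCommMonoid M] {p d m : ℕ} [Fact p.Prime]
    (hd : 1 ≤ d) (hdm : p - 1 = d * m) {g : (ZMod p)ˣ} (hg : ∀ x : (ZMod p)ˣ, ∃ n : ℕ, g ^ n = x)
    (f : ZMod p → M) {j : ℕ} (hj : j < d) {x : ZMod p} (hx : x ∈ Cset p d g (j : ZMod d)) :
    ∑ l : Fin m, f (x * (g : ZMod p) ^ (d * (l : ℕ))) = ∑ y ∈ Cset p d g (j : ZMod d), f y := by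
  obtain ⟨a, rfl⟩ := (mem_Cset_iff hj).1 hx
  have hm : 0 < m := by
    have := (Fact.out : p.Prime).two_le
    exact Nat.pos_of_ne_zero fun h => by simp [h] at hdm; omega
  have hord : orderOf g = d * m := (orderOf_eq_of_forall_pow hg).trans hdm
  refine Finset.sum_nbij (fun l : Fin m =>
    (g : ZMod p) ^ j * (a : ZMod p) ^ d * (g : ZMod p) ^ (d * (l : ℕ))) ?_ ?_ ?_ fun _ _ => rfl
  · intro l _
    refine (mem_Cset_iff hj).2 ⟨a * g ^ (l : ℕ), ?_⟩
    push_cast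
    ring
  · intro l _ l' _ h
    have h' : g ^ (d * (l : ℕ)) = g ^ (d * (l' : ℕ)) := by
      ext
      push_cast
      exact mul_left_cancel₀
        (mul_ne_zero (pow_ne_zero _ g.ne_zero) (pow_ne_zero _ a.ne_zero)) h
    have := pow_injOn_Iio_orderOf (x := g) (by rw [hord]; exact Nat.mul_lt_mul_of_pos_left l.2 hd)
      (by rw [hord]; exact Nat.mul_lt_mul_of_pos_left l'.2 hd) h'
    exact Fin.ext (Nat.eq_of_mul_eq_mul_left hd this)
  · intro y hy
    obtain ⟨b, rfl⟩ := (mem_Cset_iff hj).1 hy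
    obtain ⟨n, hn⟩ := hg (a⁻¹ * b)
    refine ⟨⟨n % m, Nat.mod_lt _ hm⟩, Finset.mem_coe.2 (Finset.mem_univ _), ?_⟩
    have h : g ^ (d * (n % m)) = (a⁻¹ * b) ^ d := by
      rw [← hn, ← pow_mul, pow_eq_pow_iff_modEq, hord, mul_comm n]
      exact (Nat.mod_modEq n m).mul_left' d
    have h' : g ^ j * a ^ d * g ^ (d * (n % m)) = g ^ j * b ^ d := by
      rw [h, mul_assoc, ← mul_pow, mul_inv_cancel_left]
    simpa using congrArg Units.val h'

/-- Summing, over a family of residues, a function that is constant on each coset. -/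
theorem sum_eq_card_nsmul_add_sum_Cset {ι M : Type*} [Fintype ι] [AddCommMonoid M] {p d m : ℕ}
    [Fact p.Prime] (hd : 1 ≤ d) (hdm : p - 1 = d * m) {g : (ZMod p)ˣ}
    (hg : ∀ x : (ZMod p)ˣ, ∃ n : ℕ, g ^ n = x) (X : ι → ZMod p) (T : ZMod p → M) (c : Fin d → M)
    (hT : ∀ (j : Fin d) (x : ZMod p), x ∈ Cset p d g ((j : ℕ) : ZMod d) → T x = c j) :
    ∑ i, T (X i) = Nat.card {i // X i = 0} • T 0 +
      ∑ j : Fin d, Nat.card {i // X i ∈ Cset p d g ((j : ℕ) : ZMod d)} • c j := by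
  classical
  have hcard (P : ι → Prop) (a : M) : Nat.card {i // P i} • a = ∑ i, if P i then a else 0 := by
    rw [Nat.card_eq_fintype_card, Fintype.card_subtype, ← Finset.sum_filter, Finset.sum_const]
  simp only [hcard]
  rw [Finset.sum_comm, ← Finset.sum_add_distrib]
  refine Finset.sum_congr rfl fun i _ => ?_
  by_cases h0 : X i = 0
  · simp [h0, zero_notMem_Cset]
  · obtain ⟨j, hj, huniq⟩ := existsUnique_mem_Cset hd hdm hg h0
    rw [if_neg h0, zero_add, Finset.sum_eq_single j, if_pos hj, hT j _ hj]
    · exact fun j' _ hne => if_neg fun h => hne (huniq j' h)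
    · simp

theorem pow_mul_pow_mem_Cset {p d : ℕ} [Fact p.Prime] (g : (ZMod p)ˣ) {j : ℕ} (hj : j < d)
    (l : ℕ) : (g : ZMod p) ^ j * (g : ZMod p) ^ (d * l) ∈ Cset p d g (j : ZMod d) :=
  (mem_Cset_iff hj).2 ⟨g ^ l, by rw [Units.val_pow_eq_pow_val, ← pow_mul, mul_comm l]⟩

theorem sum_zmodChar_mul_pow_eq_eta {p d m : ℕ} [Fact p.Prime] (hd : 1 ≤ d) (hdm : p - 1 = d * m)
    {g : (ZMod p)ˣ} (hg : ∀ x : (ZMod p)ˣ, ∃ n : ℕ, g ^ n = x) {ζ : ℂ} (hζ : ζ ^ p = 1)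
    {j : ℕ} (hj : j < d) {x : ZMod p} (hx : x ∈ Cset p d g (j : ZMod d)) :
    ∑ l : Fin m, AddChar.zmodChar p hζ (x * (g : ZMod p) ^ (d * (l : ℕ))) =
      eta p d g ζ (j : ZMod d) := by
  rw [sum_mul_pow_eq_sum_Cset hd hdm hg (fun x => AddChar.zmodChar p hζ x) hj hx]
  simp only [eta, AddChar.zmodChar_apply]

/-- A product of periods, expanded and grouped by the translations in the first factor. -/
theorem eta_mul_prod_eta {p d m n : ℕ} [Fact p.Prime] (hd : 1 ≤ d) (hdm : p - 1 = d * m)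
    {g : (ZMod p)ˣ} (hg : ∀ x : (ZMod p)ˣ, ∃ n : ℕ, g ^ n = x) {ζ : ℂ} (hζ : ζ ^ p = 1)
    {a : ℕ} (ha : a < d) (t : Fin n → ℕ) (ht : ∀ i, t i < d) :
    eta p d g ζ (a : ZMod d) * ∏ i, eta p d g ζ (t i : ZMod d) =
      ∑ J : Fin n → Fin m, ∑ l : Fin m, AddChar.zmodChar p hζ
        (((g : ZMod p) ^ a + ∑ i, (g : ZMod p) ^ (d * (J i : ℕ) + t i)) *
          (g : ZMod p) ^ (d * (l : ℕ))) := by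
  rw [Finset.sum_comm,
    ← sum_zmodChar_mul_pow_eq_eta hd hdm hg hζ ha (by simpa using pow_mul_pow_mem_Cset g ha 0),
    Finset.sum_mul]
  refine Finset.sum_congr rfl fun l _ => ?_
  have hprod : ∏ i, eta p d g ζ (t i : ZMod d) = ∏ i, ∑ r : Fin m, AddChar.zmodChar p hζ
      ((g : ZMod p) ^ (t i) * (g : ZMod p) ^ (d * (l : ℕ)) * (g : ZMod p) ^ (d * (r : ℕ))) :=
    Finset.prod_congr rfl fun i _ =>
      (sum_zmodChar_mul_pow_eq_eta hd hdm hg hζ (ht i) (pow_mul_pow_mem_Cset g (ht i) l)).symm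
  rw [hprod, Finset.prod_univ_sum, Fintype.piFinset_univ, Finset.mul_sum]
  refine Finset.sum_congr rfl fun J _ => ?_
  have hmap (f : Fin n → ZMod p) :
      ∏ i, AddChar.zmodChar p hζ (f i) = AddChar.zmodChar p hζ (∑ i, f i) :=
    (map_prod (AddChar.zmodChar p hζ).toMonoidHom (fun i => Multiplicative.ofAdd (f i)) _).symm
  rw [hmap, ← AddChar.map_add_eq_mul, add_mul, Finset.sum_mul]
  congr 2
  refine Finset.sum_congr rfl fun i _ => ?_
  ring

/-- Let 1 ≤ k ≤ d and 0 ≤ s₁ < … < s_k ≤ d−1.  With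
z = #{(j₂,…,j_k) ∈ [m]^{k−1} : g^{s₁} + g^{d·j₂+s₂} + … + g^{d·j_k+s_k} = 0} and
μ_j = #{(j₂,…,j_k) : g^{s₁} + g^{d·j₂+s₂} + … + g^{d·j_k+s_k} ∈ C_j}, one has
∏ η_{s_i} = m·z + ∑_j μ_j·η_j and z + ∑_j μ_j = m^{k−1}. -/
theorem tableau_decomposition (p d m k : ℕ) [Fact p.Prime] (hp : Odd p)
    (hd1 : 1 ≤ d) (hdm : p - 1 = d * m)
    (g : (ZMod p)ˣ) (hg : ∀ x : (ZMod p)ˣ, ∃ n : ℕ, g ^ n = x)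
    (ζ : ℂ) (hζ : IsPrimitiveRoot ζ p)
    (hk1 : 1 ≤ k) (hkd : k ≤ d)
    (s : Fin k → ℕ) (hs : StrictMono s) (hsd : ∀ i, s i ≤ d - 1)
    (z : ℕ)
    (hz : z = Nat.card {J : Fin (k - 1) → Fin m //
      (g : ZMod p) ^ (s ⟨0, hk1⟩) +
        ∑ i : Fin (k - 1),
          (g : ZMod p) ^ (d * (J i : ℕ) + s (Fin.cast (Nat.succ_pred_eq_of_pos hk1) i.succ)) = 0})
    (μ : Fin d → ℕ)
    (hμ : ∀ jj : Fin d, μ jj = Nat.card {J : Fin (k - 1) → Fin m //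
      (g : ZMod p) ^ (s ⟨0, hk1⟩) +
        (∑ i : Fin (k - 1),
          (g : ZMod p) ^ (d * (J i : ℕ) + s (Fin.cast (Nat.succ_pred_eq_of_pos hk1) i.succ)))
        ∈ Cset p d g ((jj : ℕ) : ZMod d)}) :
    ((∏ i : Fin k, eta p d g ζ ((s i : ℕ) : ZMod d))
        = (m : ℂ) * z + ∑ jj : Fin d, (μ jj : ℂ) * eta p d g ζ ((jj : ℕ) : ZMod d)) ∧
      z + ∑ jj : Fin d, μ jj = m ^ (k - 1) := by
  obtain ⟨n, rfl⟩ : ∃ n, k = n + 1 := ⟨k - 1, by omega⟩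
  have hlt (i) : s i < d := by have := hsd i; omega
  have hcount (T : ZMod p → ℂ) (c) := sum_eq_card_nsmul_add_sum_Cset (M := ℂ) hd1 hdm hg
    (fun J : Fin n → Fin m => (g : ZMod p) ^ s 0 +
      ∑ i : Fin n, (g : ZMod p) ^ (d * (J i : ℕ) + s i.succ)) T c
  have hz' : z = Nat.card {J : Fin n → Fin m // (g : ZMod p) ^ s 0 +
      ∑ i : Fin n, (g : ZMod p) ^ (d * (J i : ℕ) + s i.succ) = 0} := hz
  have hμ' (j : Fin d) : μ j = Nat.card {J : Fin n → Fin m // (g : ZMod p) ^ s 0 +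
      ∑ i : Fin n, (g : ZMod p) ^ (d * (J i : ℕ) + s i.succ) ∈
        Cset p d g ((j : ℕ) : ZMod d)} := hμ j
  simp only [← hz', ← hμ', nsmul_eq_mul] at hcount
  constructor
  · rw [Fin.prod_univ_succ,
      eta_mul_prod_eta hd1 hdm hg hζ.pow_eq_one (hlt 0) (fun i => s i.succ) fun i => hlt _,
      hcount (fun x => ∑ l : Fin m, AddChar.zmodChar p hζ.pow_eq_one
        (x * (g : ZMod p) ^ (d * (l : ℕ)))) (fun j => eta p d g ζ ((j : ℕ) : ZMod d))]
    · simp [mul_comm]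
    · intro j x hx
      exact sum_zmodChar_mul_pow_eq_eta hd1 hdm hg hζ.pow_eq_one j.2 hx
  · have h := hcount (fun _ => 1) (fun _ => 1) fun _ _ _ => rfl
    simp at h
    exact_mod_cast h.symm
end

section
/- Let 1 ≤ k ≤ d and let S be a k-element subset of ZMod d whose translation stabilizer H = {ν ∈ ZMod d : ν + S = S} has order e. Then e divides gcd(d,k), and, setting d' = d/e and k' = k/e, there exists a unique k'-element subset S* of S, all of whose elements have integer representatives in {0,1,…,d'−1}, such that S is the disjoint union of the translates S* + t·d' for t = 0,1,…,e−1. -/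
/-- The translation stabilizer `{ν ∈ ZMod d : ν + S = S}` of a subset `S ⊆ ZMod d`. -/
def stabF {d : ℕ} [NeZero d] (S : Finset (ZMod d)) : Finset (ZMod d) :=
  Finset.univ.filter fun ν => S.image (fun s => ν + s) = S

open scoped Pointwise in
/-- `stabF S` is the carrier of the stabilizer subgroup of `S` under translation. -/
theorem mem_stabF_iff_mem_stabilizer {d : ℕ} [NeZero d] {S : Finset (ZMod d)} {ν : ZMod d} :
    ν ∈ stabF S ↔ ν ∈ AddAction.stabilizer (ZMod d) S := by
  rw [stabF, Finset.mem_filter_univ, AddAction.mem_stabilizer_iff]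
  rfl

theorem natCard_addSubgroup_eq_card_of_mem_iff {G : Type*} [AddGroup G] {H : AddSubgroup G}
    {F : Finset G} (h : ∀ x, x ∈ F ↔ x ∈ H) : Nat.card H = F.card := by
  rw [← Nat.card_eq_finsetCard F]
  exact Nat.card_congr (Equiv.subtypeEquivRight fun x => (h x).symm)

/-- A subgroup of order `e` of `ZMod (e * m)` contains all multiples of `m`. -/
theorem ZMod.natCast_mul_mem_of_card_eq {d e m : ℕ} [NeZero d] (hd : d = e * m)
    (H : AddSubgroup (ZMod d)) (hH : Nat.card H = e) (t : ℕ) :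
    ((t * m : ℕ) : ZMod d) ∈ H := by
  classical
  have he : 0 < e := Nat.pos_of_ne_zero fun h => NeZero.ne d (by simp [hd, h])
  have hm : 0 < m := Nat.pos_of_ne_zero fun h => NeZero.ne d (by simp [hd, h])
  let F : Finset (ZMod d) := Finset.univ.filter (· ∈ H)
  have hF : F.card = e := by
    rw [← hH, natCard_addSubgroup_eq_card_of_mem_iff (F := F) (by simp [F])]
  let M : Finset (ZMod d) := (Finset.range e).image fun t => ((t * m : ℕ) : ZMod d)
  have hFM : F ⊆ M := by
    intro x hx
    have hx' : x ∈ H := by simpa [F] using hx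
    have hex : e • x = 0 := by
      have := card_nsmul_eq_zero' (x := (⟨x, hx'⟩ : H))
      rw [hH] at this
      exact congrArg Subtype.val this
    have hdvd : e * m ∣ e * x.val := by
      rw [← hd, ← ZMod.natCast_eq_zero_iff]
      simpa using hex
    obtain ⟨q, hq⟩ := Nat.dvd_of_mul_dvd_mul_left he hdvd
    refine Finset.mem_image.2 ⟨q, Finset.mem_range.2 ?_, ?_⟩
    · have hlt : m * q < m * e := by
        rw [← hq, mul_comm m e, ← hd]
        exact ZMod.val_lt x
      exact lt_of_mul_lt_mul_left hlt (Nat.zero_le m)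
    · rw [mul_comm, ← hq, ZMod.natCast_zmod_val]
  have hMF : F = M := Finset.eq_of_subset_of_card_le hFM
    (by rw [hF]; exact Finset.card_image_le.trans (by simp))
  have hmem : ((t % e * m : ℕ) : ZMod d) ∈ F := by
    rw [hMF]
    exact Finset.mem_image_of_mem _ (Finset.mem_range.2 (Nat.mod_lt t he))
  have hcast : ((t * m : ℕ) : ZMod d) = ((t % e * m : ℕ) : ZMod d) := by
    rw [ZMod.natCast_eq_natCast_iff', hd, Nat.mul_mod_mul_right, Nat.mul_mod_mul_right,
      Nat.mod_mod]
  rw [hcast]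
  simpa [F] using hmem

theorem ZMod.val_add_natCast_mul {d e m : ℕ} [NeZero d] (hd : d = e * m) {x : ZMod d}
    (hx : x.val < m) {t : ℕ} (ht : t < e) :
    (x + ((t * m : ℕ) : ZMod d)).val = x.val + t * m := by
  have hlt : x.val + t * m < d := by
    have := Nat.mul_le_mul_right m (Nat.succ_le_of_lt ht)
    rw [Nat.succ_mul] at this
    omega
  have hval : ((t * m : ℕ) : ZMod d).val = t * m := ZMod.val_natCast_of_lt (by omega)
  rw [ZMod.val_add_of_lt (by rwa [hval]), hval]

theorem ZMod.disjoint_image_add_natCast_mul {d e m : ℕ} [NeZero d] (hd : d = e * m)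
    {T : Finset (ZMod d)} (hT : ∀ x ∈ T, x.val < m) {t₁ t₂ : ℕ} (h₁ : t₁ < e) (h₂ : t₂ < e)
    (hne : t₁ ≠ t₂) :
    Disjoint (T.image fun x => x + ((t₁ * m : ℕ) : ZMod d))
      (T.image fun x => x + ((t₂ * m : ℕ) : ZMod d)) := by
  simp only [Finset.disjoint_left, Finset.mem_image]
  rintro _ ⟨x, hx, rfl⟩ ⟨y, hy, hxy⟩
  have hval := congrArg ZMod.val hxy
  rw [val_add_natCast_mul hd (hT y hy) h₂, val_add_natCast_mul hd (hT x hx) h₁] at hval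
  have hm : 0 < m := (Nat.zero_le _).trans_lt (hT x hx)
  have hdiv := congrArg (· / m) hval
  simp only [Nat.add_mul_div_right _ _ hm, Nat.div_eq_of_lt (hT x hx),
    Nat.div_eq_of_lt (hT y hy), zero_add] at hdiv
  exact hne hdiv.symm

/-- A set invariant under translation by the multiples of `m` is the union of the translates of
its part lying in `{0, …, m - 1}`. -/
theorem ZMod.eq_biUnion_image_add_natCast_mul {d e m : ℕ} [NeZero d] (hd : d = e * m)
    {S : Finset (ZMod d)} (hS : ∀ t : ℕ, ∀ s : ZMod d, s + ((t * m : ℕ) : ZMod d) ∈ S ↔ s ∈ S) :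
    S = (Finset.range e).biUnion
      fun t => (S.filter (·.val < m)).image fun x => x + ((t * m : ℕ) : ZMod d) := by
  have hm : 0 < m := Nat.pos_of_ne_zero fun h => NeZero.ne d (by simp [hd, h])
  ext x
  simp only [Finset.mem_biUnion, Finset.mem_range, Finset.mem_image, Finset.mem_filter]
  constructor
  · intro hx
    have hsum : ((x.val % m : ℕ) : ZMod d) + ((x.val / m * m : ℕ) : ZMod d) = x := by
      rw [← Nat.cast_add, Nat.mod_add_div', ZMod.natCast_zmod_val]
    have hmod : x.val % m < m := Nat.mod_lt _ hm
    have hmd : x.val % m < d := (Nat.mod_le _ _).trans_lt (ZMod.val_lt x)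
    refine ⟨x.val / m, ?_, ((x.val % m : ℕ) : ZMod d), ⟨?_, ?_⟩, hsum⟩
    · exact Nat.div_lt_of_lt_mul (by rw [mul_comm, ← hd]; exact ZMod.val_lt x)
    · rwa [← hS (x.val / m), hsum]
    · rwa [ZMod.val_natCast_of_lt hmd]
  · rintro ⟨t, -, y, ⟨hy, -⟩, rfl⟩
    exact (hS t y).2 hy

/-- if the translation stabilizer of a k-element subset S of ZMod d has
order e, then e ∣ gcd(d,k) and S decomposes uniquely as a disjoint union of the
translates by 0, d', 2d', …, (e−1)d' (d' = d/e) of a (k/e)-element subset S* ⊆ S whose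
elements have representatives in {0,…,d'−1}. -/
theorem stabilizer_decomposition (d k e : ℕ) [NeZero d] (hk1 : 1 ≤ k) (hkd : k ≤ d)
    (S : Finset (ZMod d)) (hS : S.card = k) (he : (stabF S).card = e) :
    e ∣ Nat.gcd d k ∧
    ∃! T : Finset (ZMod d),
      T ⊆ S ∧ T.card = k / e ∧ (∀ x ∈ T, x.val < d / e) ∧
      S = (Finset.range e).biUnion
            (fun t => T.image (fun x => x + ((t * (d / e) : ℕ) : ZMod d))) ∧
      ∀ t₁ ∈ Finset.range e, ∀ t₂ ∈ Finset.range e, t₁ ≠ t₂ →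
        Disjoint (T.image (fun x => x + ((t₁ * (d / e) : ℕ) : ZMod d)))
                 (T.image (fun x => x + ((t₂ * (d / e) : ℕ) : ZMod d))) := by
  have hcard := (natCard_addSubgroup_eq_card_of_mem_iff
    fun ν => mem_stabF_iff_mem_stabilizer (S := S) (ν := ν)).trans he
  have hed : e ∣ d := by
    rw [← hcard]
    exact (AddSubgroup.card_addSubgroup_dvd_card _).trans (by rw [Nat.card_zmod])
  have hd : d = e * (d / e) := (Nat.mul_div_cancel' hed).symm
  have hepos : 0 < e := Nat.pos_of_dvd_of_pos hed (NeZero.pos d)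
  have hinv : ∀ t : ℕ, ∀ s : ZMod d, s + ((t * (d / e) : ℕ) : ZMod d) ∈ S ↔ s ∈ S := by
    intro t s
    have hmem := mem_stabF_iff_mem_stabilizer.2 (ZMod.natCast_mul_mem_of_card_eq hd _ hcard t)
    rw [stabF, Finset.mem_filter_univ] at hmem
    nth_rewrite 1 [← hmem]
    rw [add_comm s]
    exact (add_right_injective _).mem_finset_image
  have hunion := ZMod.eq_biUnion_image_add_natCast_mul hd hinv
  set T := S.filter (·.val < d / e)
  have hT : ∀ x ∈ T, x.val < d / e := fun x hx => (Finset.mem_filter.1 hx).2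
  have hdisj : ∀ t₁ ∈ Finset.range e, ∀ t₂ ∈ Finset.range e, t₁ ≠ t₂ →
      Disjoint (T.image (fun x => x + ((t₁ * (d / e) : ℕ) : ZMod d)))
        (T.image (fun x => x + ((t₂ * (d / e) : ℕ) : ZMod d))) := fun t₁ h₁ t₂ h₂ =>
    ZMod.disjoint_image_add_natCast_mul hd hT (Finset.mem_range.1 h₁) (Finset.mem_range.1 h₂)
  have hk : k = e * T.card := by
    rw [← hS, hunion, Finset.card_biUnion hdisj]
    simp only [Finset.card_image_of_injective _ (add_left_injective _), Finset.sum_const,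
      Finset.card_range, smul_eq_mul]
  have hTk : T.card = k / e := by rw [hk, Nat.mul_div_cancel_left _ hepos]
  refine ⟨Nat.dvd_gcd hed ⟨_, hk⟩, T,
    ⟨Finset.filter_subset _ _, hTk, hT, hunion, hdisj⟩, ?_⟩
  rintro T' ⟨hT'S, hT'k, hT'lt, -, -⟩
  exact Finset.eq_of_subset_of_card_le
    (fun x hx => Finset.mem_filter.2 ⟨hT'S hx, hT'lt x hx⟩) (by rw [hTk, hT'k])
end

section
/- Let 1 ≤ k ≤ d and let e be a divisor of gcd(d,k). Then the number of k-element subsets of ZMod d whose translation stabilizer has order exactly e equals the number of (k/e)-element subsets of ZMod (d/e) whose translation stabilizer is trivial. -/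
theorem mem_stabF {d : ℕ} [NeZero d] {S : Finset (ZMod d)} {ν : ZMod d} :
    ν ∈ stabF S ↔ ∀ x, ν + x ∈ S ↔ x ∈ S := by
  simp only [stabF, Finset.mem_filter, Finset.mem_univ, true_and]
  constructor
  · intro h x
    have hx := (add_right_injective ν).mem_finset_image (s := S) (a := x)
    rwa [h] at hx
  · intro h
    ext y
    rw [← add_sub_cancel ν y, h, (add_right_injective ν).mem_finset_image]

/-- The stabilizer of `S` as an additive subgroup. -/
def stabAddSubgroup {d : ℕ} [NeZero d] (S : Finset (ZMod d)) : AddSubgroup (ZMod d) where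
  carrier := {ν | ν ∈ stabF S}
  zero_mem' := mem_stabF.2 fun x => by rw [zero_add]
  add_mem' {a b} ha hb := mem_stabF.2 fun x => by
    rw [add_assoc, mem_stabF.1 ha, mem_stabF.1 hb]
  neg_mem' {a} ha := mem_stabF.2 fun x => by
    rw [← mem_stabF.1 ha, add_neg_cancel_left]

theorem card_stabF_nsmul_eq_zero {d : ℕ} [NeZero d] {S : Finset (ZMod d)} {ν : ZMod d}
    (h : ν ∈ stabF S) : (stabF S).card • ν = 0 := by
  have hc : Nat.card (stabAddSubgroup S) = (stabF S).card :=
    Nat.card_eq_card_toFinset {ν | ν ∈ stabF S} |>.trans (by simp)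
  have h0 : Nat.card (stabAddSubgroup S) • (⟨ν, h⟩ : stabAddSubgroup S) = 0 := card_nsmul_eq_zero'
  rw [← hc]
  exact congrArg Subtype.val h0

/-- The preimage of `T` under reduction `ZMod d → ZMod m`. -/
def castPreimage {d m : ℕ} [NeZero d] (h : m ∣ d) (T : Finset (ZMod m)) : Finset (ZMod d) :=
  Finset.univ.filter fun x => ZMod.castHom h (ZMod m) x ∈ T

section

variable {d m : ℕ} [NeZero d] (h : m ∣ d)

theorem mem_castPreimage {T : Finset (ZMod m)} {x : ZMod d} :
    x ∈ castPreimage h T ↔ ZMod.castHom h (ZMod m) x ∈ T := by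
  simp only [castPreimage, Finset.mem_filter, Finset.mem_univ, true_and]

theorem castPreimage_injective : Function.Injective (castPreimage (d := d) h) := by
  intro T T' hT
  ext y
  obtain ⟨x, rfl⟩ := ZMod.castHom_surjective h y
  rw [← mem_castPreimage, hT, mem_castPreimage]

theorem card_castPreimage [NeZero m] (T : Finset (ZMod m)) :
    (castPreimage (d := d) h T).card = d / m * T.card := by
  have key (T : Finset (ZMod m)) : (castPreimage (d := d) h T).card =
      T.card * (castPreimage (d := d) h {0}).card := by
    rw [Finset.card_eq_sum_card_fiberwise (f := ZMod.castHom h (ZMod m)) (t := T)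
      fun x hx => (mem_castPreimage h).1 hx]
    refine Finset.sum_const_nat fun y hy => ?_
    obtain ⟨z, rfl⟩ := ZMod.castHom_surjective h y
    refine Finset.card_nbij' (fun x => x - z) (fun x => x + z) ?_ ?_ ?_ ?_ <;>
      simp_all [Set.MapsTo, Set.LeftInvOn, castPreimage, -ZMod.castHom_apply]
  have hd := key Finset.univ
  have : castPreimage (d := d) h Finset.univ = Finset.univ := by
    ext; simp [mem_castPreimage]
  rw [this, Finset.card_univ, Finset.card_univ, ZMod.card, ZMod.card] at hd
  have hc : d / m = (castPreimage (d := d) h {0}).card :=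
    Nat.div_eq_of_eq_mul_right (NeZero.pos m) hd
  rw [key, hc, mul_comm]

theorem stabF_castPreimage [NeZero m] (T : Finset (ZMod m)) :
    stabF (castPreimage (d := d) h T) = castPreimage h (stabF T) := by
  ext ν
  simp only [mem_castPreimage, mem_stabF, map_add]
  exact ((ZMod.castHom_surjective h).forall
    (p := fun y => ZMod.castHom h (ZMod m) ν + y ∈ T ↔ y ∈ T)).symm

end

/-- for e ∣ gcd(d,k), the number of k-element subsets of ZMod d whose
translation stabilizer has order exactly e equals the number of (k/e)-element subsets
of ZMod (d/e) with trivial translation stabilizer. -/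
theorem count_subsets_with_stabilizer (d k e : ℕ) [NeZero d] [NeZero (d / e)]
    (hk1 : 1 ≤ k) (hkd : k ≤ d) (he : e ∣ Nat.gcd d k) :
    (Finset.univ.filter fun S : Finset (ZMod d) =>
        S.card = k ∧ (stabF S).card = e).card =
    (Finset.univ.filter fun S : Finset (ZMod (d / e)) =>
        S.card = k / e ∧ (stabF S).card = 1).card := by
  have hed : e ∣ d := he.trans (Nat.gcd_dvd_left d k)
  have hek : e ∣ k := he.trans (Nat.gcd_dvd_right d k)
  have he0 : 0 < e := Nat.pos_of_dvd_of_pos hed (NeZero.pos d)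
  have hmd : d / e ∣ d := Nat.div_dvd_of_dvd hed
  have hdm : d / (d / e) = e := Nat.div_div_self hed (NeZero.ne d)
  symm
  refine Finset.card_bij (fun T _ => castPreimage hmd T) ?_
    (fun _ _ _ _ hT => castPreimage_injective hmd hT) ?_
  · intro T hT
    simp only [Finset.mem_filter, Finset.mem_univ, true_and] at hT ⊢
    rw [stabF_castPreimage, card_castPreimage, card_castPreimage, hdm, hT.1, hT.2]
    exact ⟨Nat.mul_div_cancel' hek, mul_one e⟩
  · intro S hS
    simp only [Finset.mem_filter, Finset.mem_univ, true_and] at hS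
    obtain ⟨hSk, hSe⟩ := hS
    have hsub : stabF S ⊆ castPreimage hmd {0} := by
      intro ν hν
      have h0 := card_stabF_nsmul_eq_zero hν
      rw [hSe] at h0
      rw [mem_castPreimage, Finset.mem_singleton]
      rw [← ZMod.natCast_zmod_val ν] at h0 ⊢
      rw [nsmul_eq_mul, ← Nat.cast_mul, ZMod.natCast_eq_zero_iff] at h0
      rw [map_natCast, ZMod.natCast_eq_zero_iff]
      exact Nat.dvd_of_mul_dvd_mul_left he0 (by rwa [Nat.mul_div_cancel' hed])
    have hker : stabF S = castPreimage hmd {0} :=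
      Finset.eq_of_subset_of_card_le hsub (by
        rw [card_castPreimage, hdm, hSe, Finset.card_singleton, mul_one])
    have hpre : castPreimage hmd (S.image (ZMod.castHom hmd (ZMod (d / e)))) = S := by
      ext x
      rw [mem_castPreimage, Finset.mem_image]
      refine ⟨?_, fun hx => ⟨x, hx, rfl⟩⟩
      rintro ⟨s, hs, hsx⟩
      have hν : x - s ∈ stabF S := by
        rw [hker, mem_castPreimage, Finset.mem_singleton, map_sub, hsx, sub_self]
      simpa using (mem_stabF.1 hν s).2 hs
    refine ⟨_, ?_, hpre⟩
    simp only [Finset.mem_filter, Finset.mem_univ, true_and]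
    rw [← hpre, card_castPreimage, hdm] at hSk
    rw [← hpre, stabF_castPreimage, card_castPreimage, hdm] at hSe
    exact ⟨(Nat.div_eq_of_eq_mul_right he0 hSk.symm).symm,
      Nat.eq_of_mul_eq_mul_left he0 (hSe.trans (mul_one e).symm)⟩
end

section
/- For every finite subset S ⊆ ZMod d and every ν ∈ ZMod d, the Gauss symbol is invariant under translation: N({ν + s : s ∈ S}) = N(S). -/
/-- The Gauss symbol `N(S)`: the number of functions `x : S → ZMod p` with
`x s ∈ C_s` for all `s ∈ S` and `∑_{s ∈ S} x s = 0`. -/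
noncomputable def gaussN (p d : ℕ) [NeZero p] (g : (ZMod p)ˣ) (S : Finset (ZMod d)) : ℕ :=
  Nat.card {f : S → ZMod p //
    (∀ s : S, f s ∈ Cset p d g (s : ZMod d)) ∧ ∑ s : S, f s = 0}

/-- Multiplication by `g ^ ν` carries the coset `C_s` onto `C_{ν + s}`. -/
lemma units_pow_mul_mem_Cset_add_iff {p d : ℕ} [NeZero p] [NeZero d] (g : (ZMod p)ˣ)
    (ν s : ZMod d) (x : ZMod p) :
    ((g ^ ν.val : (ZMod p)ˣ) : ZMod p) * x ∈ Cset p d g (ν + s) ↔ x ∈ Cset p d g s := by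
  obtain ⟨k, hk⟩ : ∃ k, ν.val + s.val = (ν + s).val + d * k :=
    ⟨(ν.val + s.val) / d, by rw [ZMod.val_add, Nat.mod_add_div]⟩
  have hg : g ^ ν.val * g ^ s.val = g ^ (ν + s).val * (g ^ k) ^ d := by
    rw [← pow_add, hk, pow_add, mul_comm d k, pow_mul]
  simp only [Cset, Finset.mem_filter, Finset.mem_univ, true_and]
  constructor
  · rintro ⟨y, hy⟩
    refine ⟨y * (g ^ k)⁻¹, ?_⟩
    have h : g ^ (ν + s).val * y ^ d = g ^ ν.val * (g ^ s.val * (y * (g ^ k)⁻¹) ^ d) := by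
      rw [← mul_assoc, hg, mul_assoc, ← mul_pow, mul_comm y, mul_inv_cancel_left]
    rw [← Units.mul_right_inj (g ^ ν.val), hy]
    exact_mod_cast h
  · rintro ⟨y, rfl⟩
    refine ⟨g ^ k * y, ?_⟩
    have h : g ^ ν.val * (g ^ s.val * y ^ d) = g ^ (ν + s).val * (g ^ k * y) ^ d := by
      rw [← mul_assoc, hg, mul_assoc, ← mul_pow]
    exact_mod_cast h

/-- the Gauss symbol is invariant under translation:
N(ν + S) = N(S). -/
theorem gaussN_translation_invariant (p d m : ℕ) [Fact p.Prime] [NeZero d]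
    (hp : Odd p) (hdm : p - 1 = d * m)
    (g : (ZMod p)ˣ) (hg : ∀ x : (ZMod p)ˣ, ∃ n : ℕ, g ^ n = x)
    (S : Finset (ZMod d)) (ν : ZMod d) :
    gaussN p d g (S.image fun s => ν + s) = gaussN p d g S := by
  let e : S ≃ (S.image fun s => ν + s) :=
    (Equiv.addLeft ν).subtypeEquiv fun s => by simp
  let φ := e.arrowCongr (Units.mulLeft (g ^ ν.val))
  have hφ (f : S → ZMod p) (s : S) :
      φ f (e s) = ((g ^ ν.val : (ZMod p)ˣ) : ZMod p) * f s := by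
    simp [φ, Equiv.arrowCongr]
  refine (Nat.card_congr (φ.subtypeEquiv fun f => and_congr ?_ ?_)).symm
  · rw [← e.forall_congr_right]
    refine forall_congr' fun s => ?_
    rw [hφ]
    exact (units_pow_mul_mem_Cset_add_iff g ν s (f s)).symm
  · rw [← e.sum_comp]
    simp only [hφ]
    rw [← Finset.mul_sum, Units.mul_right_eq_zero]
end

section
/- The product of all Gauss d-periods satisfies ∏_{j ∈ ZMod d} η_j = (1/d)·(p·z(ZMod d) − m^{d−1}), where z is the normalized Gauss symbol applied to the full set S = ZMod d. -/
theorem mem_Cset_natCast {p d : ℕ} [NeZero p] (g : (ZMod p)ˣ) (n : ℕ) (x : ZMod p) :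
    x ∈ Cset p d g (n : ZMod d) ↔
      ∃ y : (ZMod p)ˣ, x = (g : ZMod p) ^ n * (y : ZMod p) ^ d := by
  have key : g ^ n = g ^ (n % d) * (g ^ (n / d)) ^ d := by
    rw [← pow_mul, ← pow_add, mul_comm, Nat.mod_add_div]
  simp only [Cset, Finset.mem_filter, Finset.mem_univ, true_and, ZMod.val_natCast,
    ← Units.val_pow_eq_pow_val, ← Units.val_mul, key]
  constructor
  · rintro ⟨y, rfl⟩
    refine ⟨(g ^ (n / d))⁻¹ * y, ?_⟩
    rw [mul_pow, inv_pow, mul_assoc, mul_inv_cancel_left]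
  · rintro ⟨y, rfl⟩
    exact ⟨g ^ (n / d) * y, by rw [mul_pow, mul_assoc]⟩

/-- Multiplication by `g ^ k` maps `C_j` bijectively onto `C_{j+k}`. -/
theorem sum_Cset_add_natCast {p d : ℕ} [NeZero p] [NeZero d] {M : Type*} [AddCommMonoid M]
    (g : (ZMod p)ˣ) (k : ℕ) (j : ZMod d) (f : ZMod p → M) :
    ∑ x ∈ Cset p d g (j + k), f x = ∑ x ∈ Cset p d g j, f ((g : ZMod p) ^ k * x) := by
  obtain ⟨n, rfl⟩ := ZMod.natCast_zmod_surjective j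
  symm
  refine Finset.sum_bijective (fun x => (g : ZMod p) ^ k * x) ?_ ?_ fun _ _ => rfl
  · exact_mod_cast (g ^ k).mulLeft_bijective
  · intro x
    rw [← Nat.cast_add, mem_Cset_natCast, mem_Cset_natCast]
    refine exists_congr fun y => ?_
    rw [add_comm, pow_add, mul_assoc, ← Units.val_pow_eq_pow_val g k, Units.mul_right_inj]

theorem card_Cset {p d m : ℕ} [Fact p.Prime] [NeZero d] (hdm : p - 1 = d * m) (g : (ZMod p)ˣ)
    (s : ZMod d) : (Cset p d g s).card = m := by
  have h : Cset p d g s =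
      ((powMonoidHom d : (ZMod p)ˣ →* (ZMod p)ˣ).range : Set _).toFinite.toFinset.map
      ⟨fun u => ((g ^ s.val * u : (ZMod p)ˣ) : ZMod p),
        Units.val_injective.comp (mul_right_injective _)⟩ := by
    ext x
    simp [Cset, eq_comm]
  rw [h, Finset.card_map, ← Set.ncard_eq_toFinset_card, ← Nat.card_coe_set_eq]
  refine (IsCyclic.card_powMonoidHom_range _ d).trans ?_
  rw [Nat.card_eq_fintype_card, ZMod.card_units_eq_totient, Nat.totient_prime Fact.out, hdm,
    Nat.gcd_mul_right_left, Nat.mul_div_cancel_left _ (NeZero.pos d)]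

theorem gaussN_univ (p d : ℕ) [NeZero p] [NeZero d] (g : (ZMod p)ˣ) :
    gaussN p d g Finset.univ =
      ((Fintype.piFinset (Cset p d g)).filter fun f => ∑ s, f s = 0).card := by
  let e : (Finset.univ : Finset (ZMod d)) ≃ ZMod d := Equiv.subtypeUnivEquiv Finset.mem_univ
  rw [gaussN, ← Nat.card_eq_finsetCard]
  refine Nat.card_congr ((e.arrowCongr (Equiv.refl _)).subtypeEquiv fun f => ?_)
  simp [Fintype.mem_piFinset, Equiv.arrowCongr, e]

theorem addChar_sum_eq_prod {ι A M : Type*} [AddCommMonoid A] [CommMonoid M] (ψ : AddChar A M)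
    (s : Finset ι) (f : ι → A) : ψ (∑ i ∈ s, f i) = ∏ i ∈ s, ψ (f i) :=
  map_prod ψ.toMonoidHom (fun i => Multiplicative.ofAdd (f i)) s

theorem isIntegral_eta (p d : ℕ) [NeZero p] (g : (ZMod p)ˣ) {ζ : ℂ} (hζ : ζ ^ p = 1)
    (j : ZMod d) : IsIntegral ℤ (eta p d g ζ j) :=
  IsIntegral.sum _ fun _ _ =>
    (IsIntegral.of_pow (NeZero.pos p) (hζ ▸ isIntegral_one)).pow _

/-- The periods determine the Gauss symbol of the full set: `p N = m ^ d + (p - 1) ∏ η_j`. -/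
theorem mul_gaussN_univ {p d m : ℕ} [Fact p.Prime] [NeZero d] (hdm : p - 1 = d * m)
    (g : (ZMod p)ˣ) (hg : ∀ x : (ZMod p)ˣ, ∃ n : ℕ, g ^ n = x)
    {ζ : ℂ} (hζ : IsPrimitiveRoot ζ p) :
    (p : ℂ) * gaussN p d g Finset.univ =
      (m : ℂ) ^ d + (d * m : ℕ) * ∏ j : ZMod d, eta p d g ζ j := by
  set ψ : AddChar (ZMod p) ℂ := AddChar.zmodChar p hζ.pow_eq_one with hψ
  have hprim : ψ.IsPrimitive := AddChar.zmodChar_primitive_of_primitive_root p hζ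
  have hzero : ∏ j : ZMod d, ∑ x ∈ Cset p d g j, ψ (0 * x) = (m : ℂ) ^ d := by
    simp [card_Cset hdm]
  have hunit (a : (ZMod p)ˣ) :
      ∏ j : ZMod d, ∑ x ∈ Cset p d g j, ψ (a * x) = ∏ j : ZMod d, eta p d g ζ j := by
    obtain ⟨k, rfl⟩ := hg a
    refine Fintype.prod_equiv (Equiv.addRight (k : ZMod d)) _ _ fun j => ?_
    rw [Equiv.coe_addRight, eta, sum_Cset_add_natCast]
    simp [hψ, AddChar.zmodChar_apply]
  have hsplit : ∑ a : ZMod p, ∏ j : ZMod d, ∑ x ∈ Cset p d g j, ψ (a * x) =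
      (m : ℂ) ^ d + (d * m : ℕ) * ∏ j : ZMod d, eta p d g ζ j := by
    rw [← Finset.add_sum_erase _ _ (Finset.mem_univ 0), hzero,
      Finset.sum_congr rfl fun a ha => hunit (Units.mk0 a (Finset.ne_of_mem_erase ha)),
      Finset.sum_const, Finset.card_erase_of_mem (Finset.mem_univ _), Finset.card_univ,
      ZMod.card, hdm, nsmul_eq_mul]
  rw [← hsplit, gaussN_univ]
  simp_rw [Finset.prod_univ_sum, ← addChar_sum_eq_prod, ← Finset.mul_sum]
  rw [Finset.sum_comm]
  simp_rw [AddChar.sum_mulShift _ hprim, ZMod.card]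
  rw [← Nat.cast_sum, ← Finset.sum_filter, Finset.sum_const, smul_eq_mul, Nat.cast_mul, mul_comm]

/-- the product of all Gauss d-periods satisfies
∏_j η_j = (1/d)·(p·z(ZMod d) − m^{d−1}), where z(S) = N(S)/m and S is the full set. -/
theorem product_of_periods (p d m : ℕ) [Fact p.Prime] [NeZero d]
    (hp : Odd p) (hd2 : 2 ≤ d) (hdm : p - 1 = d * m)
    (g : (ZMod p)ˣ) (hg : ∀ x : (ZMod p)ˣ, ∃ n : ℕ, g ^ n = x)
    (ζ : ℂ) (hζ : IsPrimitiveRoot ζ p) :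
    ∏ j : ZMod d, eta p d g ζ j
      = (1 / (d : ℂ)) *
          ((p : ℂ) * ((gaussN p d g (Finset.univ : Finset (ZMod d)) / m : ℕ) : ℂ)
            - (m : ℂ) ^ (d - 1)) := by
  have hp3 : 3 ≤ p := by
    have := (Fact.out : p.Prime).two_le
    rcases hp with ⟨k, rfl⟩
    omega
  have hm : m ≠ 0 := by
    rintro rfl
    omega
  have hmp : m < p := by nlinarith [Nat.sub_le p 1, Nat.pos_of_ne_zero hm]
  have hmC : (m : ℂ) ≠ 0 := by exact_mod_cast hm
  have hdC : (d : ℂ) ≠ 0 := by exact_mod_cast NeZero.ne d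
  have hN := mul_gaussN_univ hdm g hg hζ
  have hint : IsIntegral ℤ (∏ j : ZMod d, eta p d g ζ j) :=
    IsIntegral.prod _ fun j _ => isIntegral_eta p d g hζ.pow_eq_one j
  set N := gaussN p d g Finset.univ
  set P := ∏ j : ZMod d, eta p d g ζ j
  obtain ⟨c, hc⟩ : ∃ c : ℤ, (c : ℂ) = P := by
    have hP : P = algebraMap ℚ ℂ ((p * N - m ^ d) / (d * m)) := by
      push_cast at hN
      simp only [eq_ratCast]
      push_cast
      field_simp
      linear_combination -hN
    rw [hP, isIntegral_algebraMap_iff (algebraMap ℚ ℂ).injective,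
      IsIntegrallyClosed.isIntegral_iff] at hint
    obtain ⟨c, hc⟩ := hint
    exact ⟨c, by rw [hP, ← hc]; simp⟩
  have hdvd : m ∣ N := by
    have hZ : (p : ℤ) * N = m ^ d + (d * m : ℕ) * c := by
      rw [← hc] at hN
      exact_mod_cast hN
    have h : (m : ℤ) ∣ (p * N : ℕ) := by
      push_cast
      rw [hZ]
      exact dvd_add (dvd_pow_self _ (NeZero.ne d)) (by push_cast; exact ⟨d * c, by ring⟩)
    exact (Nat.coprime_of_lt_prime hm hmp Fact.out).symm.dvd_of_dvd_mul_left
      (Int.natCast_dvd_natCast.mp h)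
  obtain ⟨z, hz⟩ := hdvd
  rw [hz, Nat.mul_div_cancel_left _ (Nat.pos_of_ne_zero hm)]
  rw [hz, ← Nat.sub_add_cancel (NeZero.one_le : 1 ≤ d), pow_succ, Nat.sub_add_cancel NeZero.one_le]
    at hN
  push_cast at hN
  field_simp
  apply mul_left_cancel₀ hmC
  linear_combination -hN
end

section
/- Let p ≡ 1 (mod 3) be a prime and let c, b be integers with 4p = c² + 27b² and c ≡ 1 (mod 3). Then 9·#{x ∈ C_1 : 1 + x ∈ C_2} = p + 1 + c. -/
/-- A prime has at most one representation `4p = x² + 27y²` up to signs. -/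
theorem Int.sq_eq_sq_of_four_mul_prime_eq {p : ℤ} (hp : Prime p) (hpos : 0 < p) {c b c' b' : ℤ}
    (h : 4 * p = c ^ 2 + 27 * b ^ 2) (h' : 4 * p = c' ^ 2 + 27 * b' ^ 2) : c ^ 2 = c' ^ 2 := by
  have key : ∀ d : ℤ, 4 * p = c' ^ 2 + 27 * d ^ 2 → p ∣ c * d - c' * b → c ^ 2 = c' ^ 2 := by
    rintro d hd ⟨k, hk⟩
    have h1 : (4 * p) ^ 2 = (c * c' + 27 * b * d) ^ 2 + 27 * (p * k) ^ 2 := by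
      rw [← hk]
      linear_combination (4 * p) * h + (c ^ 2 + 27 * b ^ 2) * hd
    have hp2 : 0 < p ^ 2 := by positivity
    have h2 : 27 * k ^ 2 ≤ 16 := by
      refine le_of_mul_le_mul_left ?_ hp2
      nlinarith [sq_nonneg (c * c' + 27 * b * d)]
    have hk0 : k = 0 := by
      have h3 : k ^ 2 < 1 := by omega
      have h4 : k ^ 2 = 0 := by linarith [sq_nonneg k]
      exact pow_eq_zero_iff (two_ne_zero) |>.mp h4
    rw [hk0, mul_zero] at hk
    have h5 : p * (d ^ 2 - b ^ 2) = 0 := by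
      have : 4 * (p * (d ^ 2 - b ^ 2)) = 0 := by
        linear_combination (c * d + c' * b) * hk + d ^ 2 * h - b ^ 2 * hd
      linarith
    have h6 : d ^ 2 - b ^ 2 = 0 := (mul_eq_zero.mp h5).resolve_left hp.ne_zero
    linear_combination hd - h + 27 * h6
  have hdvd : p ∣ (c * b' - c' * b) * (c * -b' - c' * b) :=
    ⟨-(4 * (b' ^ 2 - b ^ 2)), by linear_combination b' ^ 2 * h - b ^ 2 * h'⟩
  rcases hp.dvd_or_dvd hdvd with h1 | h1
  · exact key b' h' h1
  · exact key (-b') (by rw [neg_sq]; exact h') h1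

section CubicCharacter

variable {p : ℕ} [Fact p.Prime]

theorem jacobiSum_mul_jacobiSum_inv_self {χ : MulChar (ZMod p) ℂ} (hχ : orderOf χ = 3) :
    jacobiSum χ χ * jacobiSum χ⁻¹ χ⁻¹ = p := by
  have h1 : χ ≠ 1 := by
    rintro rfl
    simp at hχ
  have h2 : χ * χ ≠ 1 := by
    rw [← pow_two]
    exact pow_ne_one_of_lt_orderOf two_ne_zero (by omega)
  rw [jacobiSum_mul_jacobiSum_inv ?_ h1 h1 h2, ZMod.card]
  rw [ringChar.eq_zero, ZMod.ringChar_zmod_n]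
  exact (Fact.out : p.Prime).ne_zero.symm

theorem jacobiSum_inv_inv_eq_star (χ : MulChar (ZMod p) ℂ) :
    jacobiSum χ⁻¹ χ⁻¹ = star (jacobiSum χ χ) := by
  simp only [jacobiSum, ← MulChar.star_apply', star_sum, star_mul']

theorem exists_jacobiSum_add_jacobiSum_inv {χ : MulChar (ZMod p) ℂ} (hχ : orderOf χ = 3)
    (hp3 : p % 3 = 1) :
    ∃ c b : ℤ, jacobiSum χ χ + jacobiSum χ⁻¹ χ⁻¹ = c ∧
      4 * (p : ℤ) = c ^ 2 + 27 * b ^ 2 ∧ c % 3 = 1 := by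
  obtain ⟨ω, hω⟩ : ∃ ω : ℂ, IsPrimitiveRoot ω 3 := ⟨_, Complex.isPrimitiveRoot_exp 3 (by norm_num)⟩
  have hsum : 1 + ω + ω ^ 2 = 0 := by
    simpa [Finset.sum_range_succ] using hω.geom_sum_eq_zero (by norm_num)
  have hstar : star ω = -1 - ω := by
    have h1 : ω⁻¹ = ω ^ 2 := by
      rw [inv_eq_iff_eq_inv]
      exact eq_inv_of_mul_eq_one_left (by rw [← pow_succ', hω.pow_eq_one])
    have h2 : star ω = ω⁻¹ := (Complex.inv_eq_conj (hω.norm'_eq_one (by norm_num))).symm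
    rw [h2, h1]
    linear_combination hsum
  have hχ3 : χ ^ 3 = 1 := hχ ▸ pow_orderOf_eq_one χ
  obtain ⟨z, hz, hJ⟩ := exists_jacobiSum_eq_neg_one_add (by norm_num : 2 < 3) hχ3 hχ3
    (by rw [ZMod.card]; omega) hω
  obtain ⟨u, v, rfl⟩ : ∃ u v : ℤ, z = u + v * ω := by
    clear hJ
    induction hz using Algebra.adjoin_induction with
    | mem x hx => exact ⟨0, 1, by simpa using hx⟩
    | algebraMap r => exact ⟨r, 0, by simp⟩
    | add x y _ _ hx hy =>
      obtain ⟨u, v, rfl⟩ := hx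
      obtain ⟨u', v', rfl⟩ := hy
      exact ⟨u + u', v + v', by push_cast; ring⟩
    | mul x y _ _ hx hy =>
      obtain ⟨u, v, rfl⟩ := hx
      obtain ⟨u', v', rfl⟩ := hy
      exact ⟨u * u' - v * v', u * v' + v * u' - v * v', by
        push_cast; linear_combination (v * v' : ℂ) * hsum⟩
  have hJ' : jacobiSum χ χ = (3 * v - 1) + 3 * (v - u) * ω := by
    rw [hJ]
    linear_combination (u + v * ω - 3 * v : ℂ) * hsum
  have hK : jacobiSum χ⁻¹ χ⁻¹ = (3 * v - 1) + 3 * (v - u) * (-1 - ω) := by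
    rw [jacobiSum_inv_inv_eq_star, hJ', ← hstar]
    simp
  refine ⟨3 * v + 3 * u - 2, v - u, ?_, ?_, by omega⟩
  · rw [hJ', hK]
    push_cast
    ring
  · have h := jacobiSum_mul_jacobiSum_inv_self hχ
    rw [hJ', hK] at h
    have : (4 * (p : ℤ) : ℂ) = (3 * v + 3 * u - 2) ^ 2 + 27 * (v - u) ^ 2 := by
      push_cast
      linear_combination -4 * h - 36 * (v - u : ℂ) ^ 2 * hsum
    exact_mod_cast this

theorem isPrimitiveRoot_mulChar_generator {χ : MulChar (ZMod p) ℂ} {n : ℕ} (hχ : orderOf χ = n)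
    {g : (ZMod p)ˣ} (hg : ∀ x : (ZMod p)ˣ, ∃ n : ℕ, g ^ n = x) :
    IsPrimitiveRoot (χ g) n := by
  have hpow : ∀ l : ℕ, χ g ^ l = 1 ↔ χ ^ l = 1 := by
    intro l
    constructor
    · intro h
      ext x
      obtain ⟨m, rfl⟩ := hg x
      rw [MulChar.one_apply_coe, MulChar.pow_apply_coe, Units.val_pow_eq_pow_val, map_pow,
        ← pow_mul, mul_comm, pow_mul, h, one_pow]
    · intro h
      rw [← MulChar.pow_apply_coe, h, MulChar.one_apply_coe]
  subst hχ
  exact ⟨(hpow _).mpr (pow_orderOf_eq_one χ), fun l hl ↦ orderOf_dvd_of_pow_eq_one ((hpow l).mp hl)⟩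

theorem three_mul_indicator_Cset {χ : MulChar (ZMod p) ℂ} (hχ : orderOf χ = 3)
    {g : (ZMod p)ˣ} (hg : ∀ x : (ZMod p)ˣ, ∃ n : ℕ, g ^ n = x) (s : ZMod 3) (x : ZMod p) :
    (if x ∈ Cset p 3 g s then 3 else 0 : ℂ) =
      (1 : MulChar (ZMod p) ℂ) x + χ g ^ (2 * s.val) * χ x + χ g ^ s.val * χ⁻¹ x := by
  have hω := isPrimitiveRoot_mulChar_generator hχ hg
  have hχ3 : χ ^ 3 = 1 := hχ ▸ pow_orderOf_eq_one χ
  rcases eq_or_ne x 0 with rfl | hx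
  · have h0 : (0 : ZMod p) ∉ Cset p 3 g s := by
      simp only [Cset, Finset.mem_filter, Finset.mem_univ, true_and, not_exists]
      exact fun y ↦ (mul_ne_zero (pow_ne_zero _ g.ne_zero) (pow_ne_zero _ y.ne_zero)).symm
    rw [if_neg h0]
    simp [MulChar.map_zero]
  obtain ⟨n, hn⟩ := hg (Units.mk0 x hx)
  obtain rfl : (g : ZMod p) ^ n = x := by
    rw [← Units.val_pow_eq_pow_val, hn, Units.val_mk0]
  have hmem : (g : ZMod p) ^ n ∈ Cset p 3 g s ↔ n % 3 = s.val := by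
    simp only [Cset, Finset.mem_filter, Finset.mem_univ, true_and]
    constructor
    · rintro ⟨y, hy⟩
      have hy' := congrArg χ hy
      rw [map_mul, map_pow, map_pow, map_pow, ← MulChar.pow_apply_coe χ 3 y, hχ3,
        MulChar.one_apply_coe, mul_one, ← pow_mod_orderOf, ← hω.eq_orderOf] at hy'
      exact hω.pow_inj (Nat.mod_lt _ (by norm_num)) (ZMod.val_lt s) hy'
    · intro h
      refine ⟨g ^ (n / 3), ?_⟩
      rw [Units.val_pow_eq_pow_val, ← pow_mul, ← pow_add, ← h, mul_comm, Nat.mod_add_div]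
  have hinv : χ⁻¹ = χ ^ 2 := by
    rw [inv_eq_iff_mul_eq_one, ← pow_succ', hχ3]
  have hχn : χ ((g : ZMod p) ^ n) = χ g ^ (n % 3) := by
    rw [map_pow, ← pow_mod_orderOf, ← hω.eq_orderOf]
  have hone : (1 : MulChar (ZMod p) ℂ) ((g : ZMod p) ^ n) = 1 := by
    rw [map_pow, MulChar.one_apply_coe, one_pow]
  simp only [hmem]
  rw [hone, hinv, MulChar.pow_apply' _ two_ne_zero, hχn]
  have hsum : 1 + χ g + χ g ^ 2 = 0 := by
    simpa [Finset.sum_range_succ] using hω.geom_sum_eq_zero (by norm_num)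
  have h3 := hω.pow_eq_one
  have hr : n % 3 < 3 := Nat.mod_lt _ (by norm_num)
  have ht : s.val < 3 := ZMod.val_lt s
  generalize χ g = ω at *
  generalize n % 3 = r at *
  generalize s.val = t at *
  have h4 : ω ^ 4 = ω := by linear_combination ω * h3
  have h5 : ω ^ 5 = ω ^ 2 := by linear_combination ω ^ 2 * h3
  have h6 : ω ^ 6 = 1 := by linear_combination (ω ^ 3 + 1) * h3
  interval_cases r <;> interval_cases t <;> norm_num <;> ring_nf <;>
    (try simp only [h3, h4, h5, h6]) <;> first | linear_combination -hsum | norm_num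

theorem nine_mul_card_eq_jacobiSum {χ : MulChar (ZMod p) ℂ} (hχ : orderOf χ = 3)
    {g : (ZMod p)ˣ} (hg : ∀ x : (ZMod p)ˣ, ∃ n : ℕ, g ^ n = x) :
    9 * (((Cset p 3 g 1).filter fun x => 1 + x ∈ Cset p 3 g 2).card : ℂ) =
      p + 1 + (jacobiSum χ χ + jacobiSum χ⁻¹ χ⁻¹) := by
  have hω := isPrimitiveRoot_mulChar_generator hχ hg
  have hsum : 1 + χ g + χ g ^ 2 = 0 := by
    simpa [Finset.sum_range_succ] using hω.geom_sum_eq_zero (by norm_num)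
  have h3 := hω.pow_eq_one
  have hχ3 : χ ^ 3 = 1 := hχ ▸ pow_orderOf_eq_one χ
  have hχ1 : χ ≠ 1 := by
    rintro rfl
    simp at hχ
  have hneg : χ (-1) = 1 := by
    have h : (-1 : ZMod p) = (-1) ^ 3 := by norm_num
    rw [h, map_pow, ← MulChar.pow_apply' _ three_ne_zero, hχ3]
    exact MulChar.one_apply isUnit_one.neg
  have hnegx (x : ZMod p) : χ (-x) = χ x := by
    rw [neg_eq_neg_one_mul, map_mul, hneg, one_mul]
  have hcard : 9 * (((Cset p 3 g 1).filter fun x => 1 + x ∈ Cset p 3 g 2).card : ℂ) =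
      ∑ x : ZMod p, (if x ∈ Cset p 3 g 1 then 3 else 0 : ℂ) *
        (if 1 + x ∈ Cset p 3 g 2 then 3 else 0 : ℂ) := by
    have h : (Cset p 3 g 1).filter (fun x => 1 + x ∈ Cset p 3 g 2) =
        Finset.univ.filter fun x => x ∈ Cset p 3 g 1 ∧ 1 + x ∈ Cset p 3 g 2 := by
      ext x
      simp
    rw [h, Finset.card_filter, Nat.cast_sum, Finset.mul_sum]
    refine Finset.sum_congr rfl fun x _ ↦ ?_
    by_cases h1 : x ∈ Cset p 3 g 1 <;> by_cases h2 : 1 + x ∈ Cset p 3 g 2 <;>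
      simp [h1, h2]
    norm_num
  rw [hcard, ← Equiv.sum_comp (Equiv.neg (ZMod p))]
  have hone (x : ZMod p) : (1 : MulChar (ZMod p) ℂ) (-x) = (1 : MulChar (ZMod p) ℂ) x := by
    rw [neg_eq_neg_one_mul, map_mul, MulChar.one_apply isUnit_one.neg, one_mul]
  have hinvx (x : ZMod p) : χ⁻¹ (-x) = χ⁻¹ x := by
    rw [← MulChar.star_apply', ← MulChar.star_apply', hnegx]
  have hv1 : (1 : ZMod 3).val = 1 := rfl
  have hv2 : (2 : ZMod 3).val = 2 := rfl
  simp only [three_mul_indicator_Cset hχ hg, Equiv.neg_apply, hone, hnegx, hinvx, hv1, hv2,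
    ← sub_eq_add_neg]
  set ω := χ g
  have hexpand : ∀ ε : MulChar (ZMod p) ℂ, ∑ x : ZMod p,
      (ε x + ω ^ (2 * 1) * χ x + ω ^ 1 * χ⁻¹ x) *
        (ε (1 - x) + ω ^ (2 * 2) * χ (1 - x) + ω ^ 2 * χ⁻¹ (1 - x)) =
      jacobiSum ε ε + ω ^ 4 * jacobiSum ε χ + ω ^ 2 * jacobiSum ε χ⁻¹ +
      ω ^ 2 * jacobiSum χ ε + ω ^ 6 * jacobiSum χ χ + ω ^ 4 * jacobiSum χ χ⁻¹ +
      ω * jacobiSum χ⁻¹ ε + ω ^ 5 * jacobiSum χ⁻¹ χ + ω ^ 3 * jacobiSum χ⁻¹ χ⁻¹ := by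
    intro ε
    simp only [jacobiSum, Finset.mul_sum, ← Finset.sum_add_distrib]
    refine Finset.sum_congr rfl fun x _ ↦ ?_
    ring
  rw [hexpand, jacobiSum_comm χ 1, jacobiSum_comm χ⁻¹ 1, jacobiSum_comm χ⁻¹ χ,
    jacobiSum_nontrivial_inv hχ1, jacobiSum_one_one, jacobiSum_one_nontrivial hχ1,
    jacobiSum_one_nontrivial (inv_ne_one.mpr hχ1), hneg, ZMod.card]
  have h4 : ω ^ 4 = ω := by linear_combination ω * h3
  have h5 : ω ^ 5 = ω ^ 2 := by linear_combination ω ^ 2 * h3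
  have h6 : ω ^ 6 = 1 := by linear_combination (ω ^ 3 + 1) * h3
  rw [h3, h4, h5, h6]
  linear_combination -3 * hsum

end CubicCharacter

/-- for a prime p ≡ 1 (mod 3) and integers c, b with 4p = c² + 27b²
and c ≡ 1 (mod 3), one has 9·#{x ∈ C₁ : 1 + x ∈ C₂} = p + 1 + c. -/
theorem cubic_gauss_symbol (p : ℕ) [Fact p.Prime] (hp3 : p % 3 = 1)
    (g : (ZMod p)ˣ) (hg : ∀ x : (ZMod p)ˣ, ∃ n : ℕ, g ^ n = x)
    (c b : ℤ) (h4p : 4 * (p : ℤ) = c ^ 2 + 27 * b ^ 2) (hc : c % 3 = 1) :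
    9 * ((((Cset p 3 g 1).filter fun x => 1 + x ∈ Cset p 3 g 2).card : ℤ))
      = (p : ℤ) + 1 + c := by
  obtain ⟨χ, hχ⟩ : ∃ χ : MulChar (ZMod p) ℂ, orderOf χ = 3 :=
    MulChar.exists_mulChar_orderOf (ZMod p) (by rw [ZMod.card]; omega)
      (Complex.isPrimitiveRoot_exp 3 (by norm_num))
  obtain ⟨c', b', hJ, h4p', hc'⟩ := exists_jacobiSum_add_jacobiSum_inv hχ hp3
  have hp : p.Prime := Fact.out
  have hcc : c = c' := by
    have hsq := Int.sq_eq_sq_of_four_mul_prime_eq (Nat.prime_iff_prime_int.mp hp)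
      (by exact_mod_cast hp.pos) h4p h4p'
    rcases sq_eq_sq_iff_eq_or_eq_neg.mp hsq with h | h <;> omega
  have h := nine_mul_card_eq_jacobiSum hχ hg
  rw [hJ, ← hcc] at h
  exact_mod_cast h
end

section
/- Let p be an odd prime, d ≥ 2 a divisor of p−1 and m = (p−1)/d. The second Viète coefficient a_2 = ∑_{0 ≤ i < j ≤ d−1} η_i·η_j of the period polynomial satisfies: a_2 = −(d−1)(p−1)/(2d) if d is odd, or if d is even and m is even; and a_2 = (p + d − 1)/(2d) if d is even and m is odd. -/
theorem sum_range_sq_eq {R : Type*} [CommRing R] (f : ℕ → R) (n : ℕ) :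
    (∑ i ∈ Finset.range n, f i) ^ 2 =
      ∑ i ∈ Finset.range n, f i ^ 2 +
        2 * ∑ i ∈ Finset.range n, ∑ j ∈ Finset.Ioo i n, f i * f j := by
  have swap : ∑ i ∈ Finset.range n, ∑ j ∈ Finset.Ioo i n, f i * f j =
      ∑ j ∈ Finset.range n, ∑ i ∈ Finset.range j, f i * f j := by
    apply Finset.sum_comm'
    intro x y
    simp only [Finset.mem_range, Finset.mem_Ioo]
    omega
  rw [swap]
  clear swap
  induction n with
  | zero => simp
  | succ n ih =>
    simp only [Finset.sum_range_succ _ n, ← Finset.sum_mul] at ih ⊢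
    linear_combination ih

theorem ZMod.sum_range_natCast {M : Type*} [AddCommMonoid M] (d : ℕ) [NeZero d]
    (f : ZMod d → M) : ∑ i ∈ Finset.range d, f (i : ZMod d) = ∑ s, f s := by
  refine Finset.sum_bij' (fun i _ => (i : ZMod d)) (fun s _ => s.val) ?_ ?_ ?_ ?_ ?_
  · simp
  · intro s _
    simpa using ZMod.val_lt s
  · intro i hi
    exact ZMod.val_cast_of_lt (Finset.mem_range.mp hi)
  · simp
  · simp

section Cyclotomic

variable {p d m : ℕ} [Fact p.Prime] {g : (ZMod p)ˣ}

theorem orderOf_eq_sub_one_of_generates (hg : ∀ x : (ZMod p)ˣ, ∃ n : ℕ, g ^ n = x) :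
    orderOf g = p - 1 := by
  rw [← ZMod.card_units p, ← Nat.card_eq_fintype_card]
  apply orderOf_eq_card_of_forall_mem_zpowers
  intro x
  obtain ⟨n, rfl⟩ := hg x
  exact Subgroup.npow_mem_zpowers g n

theorem pow_mem_Cset_iff [NeZero d] (hdm : p - 1 = d * m)
    (hg : ∀ x : (ZMod p)ˣ, ∃ n : ℕ, g ^ n = x) (n : ℕ) (s : ZMod d) :
    ((g ^ n : (ZMod p)ˣ) : ZMod p) ∈ Cset p d g s ↔ (n : ZMod d) = s := by
  have hord := orderOf_eq_sub_one_of_generates hg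
  have hdvd : d ∣ orderOf g := by rw [hord, hdm]; exact dvd_mul_right d m
  simp only [Cset, Finset.mem_filter, Finset.mem_univ, true_and]
  constructor
  · rintro ⟨y, hy⟩
    obtain ⟨k, rfl⟩ := hg y
    have hy' : g ^ n = g ^ (s.val + k * d) := by
      apply Units.ext
      rw [hy]
      push_cast
      rw [pow_add, pow_mul]
    have h := (pow_eq_pow_iff_modEq.mp hy').of_dvd hdvd
    rw [← ZMod.natCast_eq_natCast_iff] at h
    simpa using h
  · rintro rfl
    refine ⟨g ^ (n / d), ?_⟩
    rw [ZMod.val_natCast]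
    push_cast
    rw [← pow_mul, ← pow_add, mul_comm, Nat.mod_add_div]

theorem isUnit_of_mem_Cset {s : ZMod d} {x : ZMod p} (hx : x ∈ Cset p d g s) :
    IsUnit x := by
  simp only [Cset, Finset.mem_filter, Finset.mem_univ, true_and] at hx
  obtain ⟨y, rfl⟩ := hx
  exact (g.isUnit.pow _).mul (y.isUnit.pow _)

theorem mem_Cset_zero_iff {x : ZMod p} :
    x ∈ Cset p d g 0 ↔ ∃ y : (ZMod p)ˣ, x = (y : ZMod p) ^ d := by
  cases d <;> simp [Cset]

theorem sum_sum_Cset {M : Type*} [AddCommMonoid M] [NeZero d] (hdm : p - 1 = d * m)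
    (hg : ∀ x : (ZMod p)ˣ, ∃ n : ℕ, g ^ n = x) (F : ZMod p → M) :
    ∑ s : ZMod d, ∑ x ∈ Cset p d g s, F x = ∑ x ∈ Finset.univ.erase 0, F x := by
  rw [← Finset.sum_biUnion]
  · apply Finset.sum_congr _ fun _ _ => rfl
    ext x
    simp only [Finset.mem_biUnion, Finset.mem_univ, true_and, Finset.mem_erase, and_true]
    constructor
    · rintro ⟨s, hs⟩
      exact (isUnit_of_mem_Cset hs).ne_zero
    · intro hx
      obtain ⟨n, hn⟩ := hg (Units.mk0 x hx)
      refine ⟨n, ?_⟩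
      have := (pow_mem_Cset_iff hdm hg n (n : ZMod d)).mpr rfl
      rwa [hn] at this
  · intro s _ t _ hst
    refine Finset.disjoint_left.mpr fun x hs ht => hst ?_
    obtain ⟨u, rfl⟩ := isUnit_of_mem_Cset hs
    obtain ⟨n, rfl⟩ := hg u
    rw [pow_mem_Cset_iff hdm hg] at hs ht
    exact hs.symm.trans ht

theorem sum_Cset_eq_sum_mul {M : Type*} [AddCommMonoid M] {s : ZMod d} {x : ZMod p}
    (hx : x ∈ Cset p d g s) (F : ZMod p → M) :
    ∑ y ∈ Cset p d g s, F y = ∑ u ∈ Cset p d g 0, F (x * u) := by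
  have hx0 := (isUnit_of_mem_Cset hx).ne_zero
  obtain ⟨a, ha⟩ := (Finset.mem_filter.mp hx).2
  symm
  refine Finset.sum_bij' (fun u _ => x * u) (fun y _ => x⁻¹ * y) ?_ ?_ ?_ ?_ ?_
  · intro u hu
    obtain ⟨b, rfl⟩ := mem_Cset_zero_iff.mp hu
    refine Finset.mem_filter.mpr ⟨Finset.mem_univ _, a * b, ?_⟩
    rw [ha]
    push_cast
    ring
  · intro y hy
    obtain ⟨b, rfl⟩ := (Finset.mem_filter.mp hy).2
    refine mem_Cset_zero_iff.mpr ⟨a⁻¹ * b, ?_⟩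
    have hg0 := g.ne_zero
    have ha0 := a.ne_zero
    rw [ha]
    push_cast
    rw [mul_pow, inv_pow]
    field_simp
  · intro u _
    simp [hx0]
  · intro y _
    simp [hx0]
  · simp

theorem card_Cset_zero [NeZero d] (hdm : p - 1 = d * m)
    (hg : ∀ x : (ZMod p)ˣ, ∃ n : ℕ, g ^ n = x) : (Cset p d g 0).card = m := by
  have hcard (s : ZMod d) : (Cset p d g s).card = (Cset p d g 0).card := by
    have hmem : ((g ^ s.val : (ZMod p)ˣ) : ZMod p) ∈ Cset p d g s :=
      (pow_mem_Cset_iff hdm hg _ _).mpr (by simp)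
    simpa only [Finset.card_eq_sum_ones] using sum_Cset_eq_sum_mul hmem (fun _ => 1)
  have h := sum_sum_Cset hdm hg (d := d) (fun _ => 1)
  simp only [hcard, Finset.sum_const, Finset.card_univ, ZMod.card,
    Finset.card_erase_of_mem (Finset.mem_univ _), smul_eq_mul, mul_one, hdm] at h
  exact Nat.eq_of_mul_eq_mul_left (NeZero.pos d) h

theorem neg_one_mem_Cset_zero_iff (hp : Odd p) (hdm : p - 1 = d * m)
    (hg : ∀ x : (ZMod p)ˣ, ∃ n : ℕ, g ^ n = x) :
    (-1 : ZMod p) ∈ Cset p d g 0 ↔ Odd d ∨ Even m := by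
  have hp2 : 2 < p := by
    have := (Fact.out : p.Prime).two_le
    obtain ⟨k, rfl⟩ := hp
    omega
  rw [mem_Cset_zero_iff]
  constructor
  · rintro ⟨y, hy⟩
    by_contra! h
    have hm : Odd m := Nat.not_even_iff_odd.mp h.2
    have h1 := ZMod.pow_card_sub_one_eq_one y.ne_zero
    rw [hdm, pow_mul, ← hy, hm.neg_one_pow] at h1
    have : Fact (2 < p) := ⟨hp2⟩
    exact ZMod.neg_one_ne_one h1
  · rintro (hd | ⟨k, rfl⟩)
    · exact ⟨-1, by simp [hd.neg_one_pow]⟩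
    · refine ⟨g ^ k, ?_⟩
      have hord := orderOf_eq_sub_one_of_generates hg
      have hsq : ((g : ZMod p) ^ (k * d)) ^ 2 = 1 := by
        rw [← pow_mul, ← ZMod.pow_card_sub_one_eq_one g.ne_zero, hdm]
        ring
      rcases sq_eq_sq_iff_eq_or_eq_neg.mp (hsq.trans (one_pow 2).symm) with h | h
      · exfalso
        have h' : g ^ (k * d) = 1 := Units.ext (by simpa using h)
        have hdvd := orderOf_dvd_of_pow_eq_one h'
        have hpos : 0 < k * d := by
          rcases Nat.eq_zero_or_pos (k * d) with h0 | h0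
          · have : d * (k + k) = 2 * (k * d) := by ring
            omega
          · exact h0
        have hle := Nat.le_of_dvd hpos hdvd
        have : d * (k + k) = 2 * (k * d) := by ring
        omega
      · push_cast
        rw [← pow_mul, h]

variable [NeZero d] {ζ : ℂ}

theorem sum_erase_zero_pow_val_mul (hζ : IsPrimitiveRoot ζ p) (b : ZMod p) :
    ∑ x ∈ Finset.univ.erase (0 : ZMod p), ζ ^ (x * b).val =
      (if b = 0 then (p : ℂ) else 0) - 1 := by
  have h := AddChar.sum_mulShift b
    (AddChar.zmodChar_primitive_of_primitive_root p hζ)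
  simp only [AddChar.zmodChar_apply, ZMod.card] at h
  rw [← Finset.add_sum_erase _ _ (Finset.mem_univ (0 : ZMod p))] at h
  simp only [zero_mul, ZMod.val_zero, pow_zero] at h
  push_cast at h
  linear_combination h

theorem sum_eta (hdm : p - 1 = d * m) (hg : ∀ x : (ZMod p)ˣ, ∃ n : ℕ, g ^ n = x)
    (hζ : IsPrimitiveRoot ζ p) : ∑ s : ZMod d, eta p d g ζ s = -1 := by
  simp only [eta]
  rw [sum_sum_Cset hdm hg (fun x => ζ ^ x.val)]
  simpa using sum_erase_zero_pow_val_mul hζ 1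

theorem sum_eta_sq (hdm : p - 1 = d * m) (hg : ∀ x : (ZMod p)ˣ, ∃ n : ℕ, g ^ n = x)
    (hζ : IsPrimitiveRoot ζ p) :
    ∑ s : ZMod d, eta p d g ζ s ^ 2 =
      (if (-1 : ZMod p) ∈ Cset p d g 0 then (p : ℂ) else 0) - m := by
  have hsq (s : ZMod d) : eta p d g ζ s ^ 2 =
      ∑ x ∈ Cset p d g s, ∑ u ∈ Cset p d g 0, ζ ^ (x * (1 + u)).val := by
    rw [sq, eta, Finset.sum_mul]
    refine Finset.sum_congr rfl fun x hx => ?_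
    rw [sum_Cset_eq_sum_mul hx, Finset.mul_sum]
    refine Finset.sum_congr rfl fun u _ => ?_
    simp only [← AddChar.zmodChar_apply hζ.pow_eq_one]
    rw [← AddChar.map_add_eq_mul, mul_add, mul_one]
  simp only [hsq]
  rw [sum_sum_Cset hdm hg (fun x => ∑ u ∈ Cset p d g 0, ζ ^ (x * (1 + u)).val),
    Finset.sum_comm]
  simp only [sum_erase_zero_pow_val_mul hζ, Finset.sum_sub_distrib, Finset.sum_const,
    card_Cset_zero hdm hg, nsmul_eq_mul, mul_one, add_comm (1 : ZMod p),
    add_eq_zero_iff_eq_neg, Finset.sum_ite_eq']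

end Cyclotomic

/-- Proposition 13: the second Viète coefficient
a₂ = ∑_{0 ≤ i < j ≤ d−1} η_i·η_j satisfies a₂ = −(d−1)(p−1)/(2d) when d is odd or
when d and m are both even, and a₂ = (p + d − 1)/(2d) when d is even and m is odd. -/
theorem second_viete_coefficient (p d m : ℕ) [Fact p.Prime] [NeZero d]
    (hp : Odd p) (hd2 : 2 ≤ d) (hdm : p - 1 = d * m)
    (g : (ZMod p)ˣ) (hg : ∀ x : (ZMod p)ˣ, ∃ n : ℕ, g ^ n = x)
    (ζ : ℂ) (hζ : IsPrimitiveRoot ζ p)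
    (a₂ : ℂ)
    (ha : a₂ = ∑ i ∈ Finset.range d, ∑ j ∈ Finset.Ioo i d,
        eta p d g ζ (i : ZMod d) * eta p d g ζ (j : ZMod d)) :
    ((Odd d ∨ (Even d ∧ Even m)) →
        a₂ = -(((d : ℂ) - 1) * ((p : ℂ) - 1)) / (2 * (d : ℂ))) ∧
    ((Even d ∧ Odd m) →
        a₂ = ((p : ℂ) + (d : ℂ) - 1) / (2 * (d : ℂ))) := by
  have hS := sum_eta (d := d) hdm hg hζ
  have hQ := sum_eta_sq (d := d) hdm hg hζ
  have h := sum_range_sq_eq (fun i : ℕ => eta p d g ζ (i : ZMod d)) d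
  rw [ZMod.sum_range_natCast d (eta p d g ζ),
    ZMod.sum_range_natCast d (fun s => eta p d g ζ s ^ 2), ← ha, hS, hQ] at h
  have hd0 : (d : ℂ) ≠ 0 := NeZero.ne _
  have hpm : (p : ℂ) - 1 = d * m := by
    rw [← Nat.cast_one, ← Nat.cast_sub (Fact.out : p.Prime).one_le, hdm, Nat.cast_mul]
  have hneg := neg_one_mem_Cset_zero_iff hp hdm hg
  constructor
  · intro hc
    rw [if_pos (hneg.mpr (hc.imp_right And.right))] at h
    rw [eq_div_iff (by simpa using hd0)]
    linear_combination -(d : ℂ) * h - hpm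
  · rintro ⟨hd, hm⟩
    rw [if_neg (by simpa [hneg] using ⟨hd, hm⟩)] at h
    rw [eq_div_iff (by simpa using hd0)]
    linear_combination -(d : ℂ) * h - hpm
end

section
/- Let p ≡ 1 (mod 4) be a prime and write p = s² + 4t² with integers s, t and s ≡ 1 (mod 4). If p ≡ 1 (mod 8), then 16·#{x ∈ C_1 : 1 + x ∈ C_2} = p + 1 − 2s; if p ≡ 5 (mod 8), then 16·#{x ∈ C_1 : 1 + x ∈ C_0} = p − 3 − 2s. -/
open Finset GaussianInt Zsqrtd

theorem GaussianInt.sqrtd_sq : (sqrtd : GaussianInt) ^ 2 = -1 := by decide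

theorem GaussianInt.sqrtd_pow_four : (sqrtd : GaussianInt) ^ 4 = 1 := by decide

/-- An inversion substitution relates the Jacobi sums `J(χ, χ)` and `J(χ, χ⁻²)`. -/
theorem jacobiSum_self {F R : Type*} [Field F] [Fintype F] [CommRing R] (χ : MulChar F R) :
    jacobiSum χ χ = χ (-1) * jacobiSum χ (χ ^ 2)⁻¹ := by
  rw [jacobiSum_comm χ (χ ^ 2)⁻¹, jacobiSum, jacobiSum, mul_sum,
    ← Equiv.sum_comp (Equiv.inv F) (fun x => χ x * χ (1 - x))]
  refine sum_congr rfl fun x _ => ?_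
  rcases eq_or_ne x 0 with rfl | hx
  · simp [MulChar.map_zero]
  · rw [Equiv.inv_apply, MulChar.inv_apply', MulChar.pow_apply' _ two_ne_zero, mul_left_comm,
      ← map_mul, ← map_mul, ← map_pow, ← map_mul]
    congr 1
    field_simp
    ring

/-- Expansion of a correlation of two combinations of powers of `χ` in Jacobi sums. -/
theorem sum_mul_eq_sum_jacobiSum {F R : Type*} [Field F] [Fintype F] [CommRing R]
    (χ : MulChar F R) (n : ℕ) (c d : ℕ → R) :
    ∑ x : F, (∑ a ∈ range n, c a * (χ ^ a) x) * (∑ b ∈ range n, d b * (χ ^ b) (1 + x)) =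
      ∑ a ∈ range n, ∑ b ∈ range n,
        c a * d b * χ (-1) ^ a * jacobiSum (χ ^ a) (χ ^ b) := by
  rw [← Equiv.sum_comp (Equiv.neg F)]
  simp_rw [sum_mul_sum, jacobiSum, mul_sum]
  rw [sum_comm]
  refine sum_congr rfl fun a _ => ?_
  rw [sum_comm]
  refine sum_congr rfl fun b _ => sum_congr rfl fun x _ => ?_
  have h := MulChar.pow_apply_coe χ a (-1)
  rw [Units.val_neg, Units.val_one] at h
  rw [Equiv.neg_apply, ← sub_eq_add_neg, neg_eq_neg_one_mul x, map_mul, h]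
  ring

section QuarticCharacter

variable {p : ℕ} [Fact p.Prime] {g : (ZMod p)ˣ}

theorem exists_quartic_mulChar (hp4 : p % 4 = 1) (hg : ∀ x : (ZMod p)ˣ, ∃ n : ℕ, g ^ n = x) :
    ∃ χ : MulChar (ZMod p) GaussianInt, χ g = sqrtd := by
  have hu : IsUnit (sqrtd : GaussianInt) :=
    IsUnit.of_pow_eq_one GaussianInt.sqrtd_pow_four four_ne_zero
  have hζ : hu.unit ∈ rootsOfUnity (Fintype.card (ZMod p)ˣ) GaussianInt := by
    rw [mem_rootsOfUnity, Units.ext_iff, ZMod.card_units]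
    obtain ⟨k, hk⟩ : 4 ∣ p - 1 := by lia
    simp [hk, pow_mul, GaussianInt.sqrtd_pow_four]
  have hz : ∀ x, x ∈ Subgroup.zpowers g := fun x => by
    obtain ⟨n, rfl⟩ := hg x
    exact Subgroup.npow_mem_zpowers g n
  exact ⟨MulChar.ofRootOfUnity hζ hz, MulChar.ofRootOfUnity_spec hζ hz⟩

variable {χ : MulChar (ZMod p) GaussianInt}

theorem quartic_mulChar_pow_generator (hχ : χ g = sqrtd) (n : ℕ) :
    χ ((g ^ n : (ZMod p)ˣ) : ZMod p) = sqrtd ^ n := by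
  rw [Units.val_pow_eq_pow_val, map_pow, hχ]

theorem mem_Cset_iff_s19 (hg : ∀ x : (ZMod p)ˣ, ∃ n : ℕ, g ^ n = x) (hχ : χ g = sqrtd)
    (j : ZMod 4) (x : ZMod p) : x ∈ Cset p 4 g j ↔ χ x = sqrtd ^ j.val := by
  simp only [Cset, mem_filter, mem_univ, true_and]
  constructor
  · rintro ⟨y, rfl⟩
    obtain ⟨n, rfl⟩ := hg y
    rw [map_mul, map_pow, map_pow, hχ, quartic_mulChar_pow_generator hχ, ← pow_mul, mul_comm n,
      pow_mul, GaussianInt.sqrtd_pow_four, one_pow, mul_one]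
  · intro h
    have hx : IsUnit x := by
      by_contra hx
      rw [MulChar.map_nonunit _ hx] at h
      exact absurd h.symm (pow_ne_zero _ (by decide))
    obtain ⟨u, rfl⟩ := hx
    obtain ⟨n, rfl⟩ := hg u
    refine ⟨g ^ (n / 4), ?_⟩
    rw [quartic_mulChar_pow_generator hχ, pow_eq_pow_mod n GaussianInt.sqrtd_pow_four] at h
    have hn : n % 4 = j.val := by
      have hj : j.val < 4 := ZMod.val_lt j
      have hn4 : n % 4 < 4 := Nat.mod_lt _ four_pos
      generalize n % 4 = m at h hn4
      generalize j.val = k at h hj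
      revert h
      interval_cases m <;> interval_cases k <;> decide
    rw [← hn, Units.val_pow_eq_pow_val, Units.val_pow_eq_pow_val, ← pow_mul, ← pow_add,
      mul_comm (n / 4), Nat.mod_add_div]

/-- Fourier expansion of the indicator function of `C_j`. -/
theorem sum_quartic_mulChar_pow (hg : ∀ x : (ZMod p)ˣ, ∃ n : ℕ, g ^ n = x) (hχ : χ g = sqrtd)
    (j : ZMod 4) (x : ZMod p) :
    ∑ a ∈ range 4, ((-sqrtd) ^ j.val) ^ a * (χ ^ a) x = if x ∈ Cset p 4 g j then 4 else 0 := by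
  simp only [mem_Cset_iff_s19 hg hχ]
  by_cases hx : IsUnit x
  · obtain ⟨u, rfl⟩ := hx
    obtain ⟨n, rfl⟩ := hg u
    simp_rw [MulChar.pow_apply_coe, quartic_mulChar_pow_generator hχ,
      pow_eq_pow_mod n GaussianInt.sqrtd_pow_four]
    have hn : n % 4 < 4 := Nat.mod_lt _ four_pos
    generalize n % 4 = m at hn
    revert j
    interval_cases m <;> decide
  · rw [MulChar.map_nonunit _ hx, if_neg (pow_ne_zero _ (by decide)).symm]
    exact sum_eq_zero fun a _ => by rw [MulChar.map_nonunit _ hx, mul_zero]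

/-- Sixteen times a cyclotomic number of order four, in terms of Jacobi sums. -/
theorem sixteen_mul_card_filter_Cset (hg : ∀ x : (ZMod p)ˣ, ∃ n : ℕ, g ^ n = x)
    (hχ : χ g = sqrtd) (j k : ZMod 4) :
    (16 * ((((Cset p 4 g j).filter fun x => 1 + x ∈ Cset p 4 g k).card : ℤ)) : GaussianInt) =
      ∑ a ∈ range 4, ∑ b ∈ range 4, ((-sqrtd) ^ j.val) ^ a * ((-sqrtd) ^ k.val) ^ b *
        χ (-1) ^ a * jacobiSum (χ ^ a) (χ ^ b) := by
  rw [← sum_mul_eq_sum_jacobiSum]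
  simp_rw [sum_quartic_mulChar_pow hg hχ]
  rw [card_filter, Nat.cast_sum, Int.cast_sum, mul_sum, ← sum_filter_add_sum_filter_not univ
    (· ∈ Cset p 4 g j), filter_mem_eq_inter, univ_inter, sum_eq_zero (s := filter _ _), add_zero]
  · refine sum_congr rfl fun x hx => ?_
    rw [if_pos hx]
    split_ifs <;> norm_num
  · intro x hx
    rw [if_neg (mem_filter.1 hx).2, zero_mul]

theorem quartic_mulChar_ext (hg : ∀ x : (ZMod p)ˣ, ∃ n : ℕ, g ^ n = x)
    {φ ψ : MulChar (ZMod p) GaussianInt} (h : φ g = ψ g) : φ = ψ := by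
  refine (MulChar.eq_iff (fun x => ?_) φ ψ).2 h
  obtain ⟨n, rfl⟩ := hg x
  exact Subgroup.npow_mem_zpowers g n

theorem quartic_mulChar_pow_four (hg : ∀ x : (ZMod p)ˣ, ∃ n : ℕ, g ^ n = x)
    (hχ : χ g = sqrtd) : χ ^ 4 = 1 :=
  quartic_mulChar_ext hg <| by
    rw [MulChar.pow_apply_coe, hχ, GaussianInt.sqrtd_pow_four, MulChar.one_apply_coe]

theorem quartic_mulChar_pow_ne_one (hχ : χ g = sqrtd) {n : ℕ}
    (hn : (sqrtd : GaussianInt) ^ n ≠ 1) : χ ^ n ≠ 1 := by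
  refine MulChar.ne_one_iff.2 ⟨g, ?_⟩
  rwa [MulChar.pow_apply_coe, hχ]

theorem quartic_mulChar_neg_one (hp4 : p % 4 = 1) (hg : ∀ x : (ZMod p)ˣ, ∃ n : ℕ, g ^ n = x)
    (hχ : χ g = sqrtd) : χ (-1) = sqrtd ^ ((p - 1) / 2) := by
  have hord : orderOf g = p - 1 := by
    rw [← ZMod.card_units p, ← Nat.card_eq_fintype_card]
    refine orderOf_eq_card_of_forall_mem_zpowers fun x => ?_
    obtain ⟨n, rfl⟩ := hg x
    exact Subgroup.npow_mem_zpowers g n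
  have hp : 1 < p := (Fact.out : p.Prime).one_lt
  have hsq : ((g : ZMod p) ^ ((p - 1) / 2)) ^ 2 = 1 := by
    rw [← pow_mul, Nat.div_mul_cancel (by lia), ← hord, ← Units.val_pow_eq_pow_val,
      pow_orderOf_eq_one, Units.val_one]
  have hne : (g : ZMod p) ^ ((p - 1) / 2) ≠ 1 := fun h =>
    pow_ne_one_of_lt_orderOf (x := g) (n := (p - 1) / 2) (by lia) (by lia)
      (Units.ext (by simpa using h))
  rw [← (sq_eq_one_iff.1 hsq).resolve_left hne, map_pow, hχ]

theorem quartic_mulChar_ringHomComp_star (hg : ∀ x : (ZMod p)ˣ, ∃ n : ℕ, g ^ n = x)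
    (hχ : χ g = sqrtd) : χ.ringHomComp (starRingEnd GaussianInt) = χ ^ 3 :=
  quartic_mulChar_ext hg <| by
    rw [MulChar.pow_apply_coe, MulChar.ringHomComp_apply, hχ]
    decide

theorem jacobiSum_quartic_pow_three_sq (hg : ∀ x : (ZMod p)ˣ, ∃ n : ℕ, g ^ n = x)
    (hχ : χ g = sqrtd) :
    jacobiSum (χ ^ 3) (χ ^ 2) = star (jacobiSum χ (χ ^ 2)) := by
  have h2 : (χ ^ 3) ^ 2 = χ ^ 2 := by
    rw [← pow_mul, pow_eq_pow_mod _ (quartic_mulChar_pow_four hg hχ)]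
  rw [← starRingEnd_apply, ← jacobiSum_ringHomComp, ← MulChar.ringHomComp_pow,
    quartic_mulChar_ringHomComp_star hg hχ, h2]

/-- The quartic Jacobi sum has norm `p`. -/
theorem norm_jacobiSum_quartic (hg : ∀ x : (ZMod p)ˣ, ∃ n : ℕ, g ^ n = x) (hχ : χ g = sqrtd) :
    (jacobiSum χ (χ ^ 2)).re ^ 2 + (jacobiSum χ (χ ^ 2)).im ^ 2 = p := by
  have h4 := quartic_mulChar_pow_four hg hχ
  have hinv : χ⁻¹ = χ ^ 3 := inv_eq_of_mul_eq_one_right (by rw [← pow_succ', h4])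
  have hinv2 : (χ ^ 2)⁻¹ = χ ^ 2 := inv_eq_of_mul_eq_one_right (by rw [← pow_add, h4])
  have hinj := GaussianInt.toComplex_injective
  have hchar : ringChar ℂ ≠ ringChar (ZMod p) := by
    rw [ringChar.eq_zero, ZMod.ringChar_zmod_n]
    exact (Fact.out : p.Prime).ne_zero.symm
  have h := jacobiSum_mul_jacobiSum_inv hchar
    (χ := χ.ringHomComp toComplex) (φ := (χ ^ 2).ringHomComp toComplex)
    ((MulChar.ringHomComp_ne_one_iff hinj).2
      (by simpa using quartic_mulChar_pow_ne_one hχ (n := 1) (by decide)))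
    ((MulChar.ringHomComp_ne_one_iff hinj).2 (quartic_mulChar_pow_ne_one hχ (by decide)))
    (by
      rw [← MulChar.ringHomComp_mul, ← pow_succ']
      exact (MulChar.ringHomComp_ne_one_iff hinj).2 (quartic_mulChar_pow_ne_one hχ (by decide)))
  rw [MulChar.ringHomComp_inv, MulChar.ringHomComp_inv, hinv, hinv2, jacobiSum_ringHomComp,
    jacobiSum_ringHomComp, jacobiSum_quartic_pow_three_sq hg hχ, ZMod.card, ← map_mul,
    ← map_natCast toComplex, hinj.eq_iff] at h
  have hre := congrArg Zsqrtd.re h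
  simp only [Zsqrtd.re_mul, Zsqrtd.re_star, Zsqrtd.im_star, Zsqrtd.re_natCast] at hre
  linarith

/-- The sixteen Jacobi sums of powers of `χ` combined with arbitrary weights. -/
theorem sum_jacobiSum_quartic (hg : ∀ x : (ZMod p)ˣ, ∃ n : ℕ, g ^ n = x) (hχ : χ g = sqrtd)
    (hsq : χ (-1) ^ 2 = 1) (c d : ℕ → GaussianInt) :
    ∑ a ∈ range 4, ∑ b ∈ range 4, c a * d b * χ (-1) ^ a * jacobiSum (χ ^ a) (χ ^ b) =
      c 0 * d 0 * (p - 2) - c 0 * (d 1 + d 2 + d 3) - d 0 * (χ (-1) * (c 1 + c 3) + c 2)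
        - (c 1 * d 3 + c 2 * d 2 + c 3 * d 1)
        + (c 1 * d 1 + χ (-1) * (c 1 * d 2) + c 2 * d 1) * jacobiSum χ (χ ^ 2)
        + (c 3 * d 3 + χ (-1) * (c 3 * d 2) + c 2 * d 3) * star (jacobiSum χ (χ ^ 2)) := by
  have h4 := quartic_mulChar_pow_four hg hχ
  have hinv : χ⁻¹ = χ ^ 3 := inv_eq_of_mul_eq_one_right (by rw [← pow_succ', h4])
  have hinv2 : (χ ^ 2)⁻¹ = χ ^ 2 := inv_eq_of_mul_eq_one_right (by rw [← pow_add, h4])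
  have h32 : ((χ ^ 3) ^ 2)⁻¹ = χ ^ 2 := by
    rw [← hinv2, ← pow_mul, pow_eq_pow_mod _ h4]
  have hχ1 : χ ≠ 1 := by simpa using quartic_mulChar_pow_ne_one hχ (n := 1) (by decide)
  have hχ2 : χ ^ 2 ≠ 1 := quartic_mulChar_pow_ne_one hχ (by decide)
  have hχ3 : χ ^ 3 ≠ 1 := quartic_mulChar_pow_ne_one hχ (by decide)
  have hneg2 : (χ ^ 2) (-1) = 1 := by rw [MulChar.pow_apply' _ two_ne_zero, hsq]
  have hcube : χ (-1) ^ 3 = χ (-1) := by rw [pow_succ, hsq, one_mul]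
  have hneg3 : (χ ^ 3) (-1) = χ (-1) := by rw [MulChar.pow_apply' _ three_ne_zero, hcube]
  have h11 : jacobiSum χ χ = χ (-1) * jacobiSum χ (χ ^ 2) := by rw [jacobiSum_self, hinv2]
  have h13 : jacobiSum χ (χ ^ 3) = -χ (-1) := by rw [← hinv, jacobiSum_nontrivial_inv hχ1]
  have h22 : jacobiSum (χ ^ 2) (χ ^ 2) = -1 := by
    conv_lhs => arg 2; rw [← hinv2]
    rw [jacobiSum_nontrivial_inv hχ2, hneg2]
  have hstar := jacobiSum_quartic_pow_three_sq hg hχ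
  have h33 : jacobiSum (χ ^ 3) (χ ^ 3) = χ (-1) * star (jacobiSum χ (χ ^ 2)) := by
    rw [jacobiSum_self, h32, hneg3, hstar]
  simp only [sum_range_succ, range_zero, sum_empty, zero_add, pow_zero, pow_one]
  rw [jacobiSum_one_one, ZMod.card, jacobiSum_comm χ 1, jacobiSum_comm (χ ^ 2) 1,
    jacobiSum_comm (χ ^ 3) 1, jacobiSum_one_nontrivial hχ1, jacobiSum_one_nontrivial hχ2,
    jacobiSum_one_nontrivial hχ3, h11, h13, h22, h33, hstar, jacobiSum_comm (χ ^ 2) χ,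
    jacobiSum_comm (χ ^ 3) χ, h13, jacobiSum_comm (χ ^ 2) (χ ^ 3), hstar, hcube, hsq]
  linear_combination (c 1 * d 1 * jacobiSum χ (χ ^ 2) - c 1 * d 3 - c 3 * d 1
    + c 3 * d 3 * star (jacobiSum χ (χ ^ 2))) * hsq

end QuarticCharacter

/-- Uniqueness of the representation of a prime as a sum of two squares, normalised so that the
first square has a base congruent to `1` modulo `4`. -/
theorem eq_of_sq_add_sq_eq_prime {p : ℕ} (hp : p.Prime) {a b s c : ℤ}
    (hab : a ^ 2 + b ^ 2 = p) (hsc : s ^ 2 + c ^ 2 = p) (ha : a % 4 = 1) (hs : s % 4 = 1)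
    (hc : 2 ∣ c) : a = s := by
  have hp0 : (p : ℤ) ≠ 0 := by exact_mod_cast hp.ne_zero
  have key : ∀ c : ℤ, s ^ 2 + c ^ 2 = p → 2 ∣ c → (p : ℤ) ∣ a * s - b * c → a = s := by
    rintro c hsc ⟨c, rfl⟩ ⟨k, hk⟩
    have hprod : (p * k) ^ 2 + (a * (2 * c) + b * s) ^ 2 = (p : ℤ) ^ 2 := by
      rw [← hk, sq (p : ℤ)]
      nth_rewrite 1 [← hab]
      rw [← hsc]
      ring
    have hodd : a * s % 2 = 1 := by
      rw [Int.mul_emod, show a % 2 = 1 by lia, show s % 2 = 1 by lia]; rfl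
    have hk0 : k ≠ 0 := by
      rintro rfl
      have : a * s = 2 * (b * c) := by linear_combination hk
      lia
    have hk1 : 1 ≤ k ^ 2 := by have := sq_pos_of_ne_zero hk0; lia
    have hzero : a * (2 * c) + b * s = 0 := by
      have h1 : (p : ℤ) ^ 2 * 1 ≤ (p : ℤ) ^ 2 * k ^ 2 :=
        mul_le_mul_of_nonneg_left hk1 (sq_nonneg _)
      exact pow_eq_zero_iff two_ne_zero |>.1 (le_antisymm (by nlinarith) (sq_nonneg _))
    have hsq : a ^ 2 = s ^ 2 := mul_left_cancel₀ hp0 <| by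
      linear_combination (a * (2 * c) - b * s) * hzero - a ^ 2 * hsc + s ^ 2 * hab
    rcases sq_eq_sq_iff_eq_or_eq_neg.1 hsq with h | h <;> lia
  have hdvd : (p : ℤ) ∣ (a * s - b * c) * (a * s - b * -c) :=
    ⟨a ^ 2 - c ^ 2, by linear_combination a ^ 2 * hsc - c ^ 2 * hab⟩
  rcases (Nat.prime_iff_prime_int.1 hp).dvd_or_dvd hdvd with h | h
  · exact key c hsc hc h
  · exact key (-c) (by rw [neg_sq, hsc]) (by simpa using hc) h

/-- for a prime p ≡ 1 (mod 4), writing p = s² + 4t² with s ≡ 1 (mod 4):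
if p ≡ 1 (mod 8) then 16·#{x ∈ C₁ : 1 + x ∈ C₂} = p + 1 − 2s, and
if p ≡ 5 (mod 8) then 16·#{x ∈ C₁ : 1 + x ∈ C₀} = p − 3 − 2s. -/
theorem biquadratic_gauss_symbols (p : ℕ) [Fact p.Prime] (hp4 : p % 4 = 1)
    (g : (ZMod p)ˣ) (hg : ∀ x : (ZMod p)ˣ, ∃ n : ℕ, g ^ n = x)
    (s t : ℤ) (hst : (p : ℤ) = s ^ 2 + 4 * t ^ 2) (hs : s % 4 = 1) :
    (p % 8 = 1 →
      16 * ((((Cset p 4 g 1).filter fun x => 1 + x ∈ Cset p 4 g 2).card : ℤ))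
        = (p : ℤ) + 1 - 2 * s) ∧
    (p % 8 = 5 →
      16 * ((((Cset p 4 g 1).filter fun x => 1 + x ∈ Cset p 4 g 0).card : ℤ))
        = (p : ℤ) - 3 - 2 * s) := by
  obtain ⟨χ, hχ⟩ := exists_quartic_mulChar hp4 hg
  have hneg := quartic_mulChar_neg_one hp4 hg hχ
  have hnorm := norm_jacobiSum_quartic hg hχ
  have hst' : s ^ 2 + (2 * t) ^ 2 = p := by rw [hst]; ring
  have huniq : ∀ {a : ℤ}, a ^ 2 + (jacobiSum χ (χ ^ 2)).im ^ 2 = p → a % 4 = 1 → a = s :=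
    fun h ha => eq_of_sq_add_sq_eq_prime Fact.out h hst' ha hs ⟨t, rfl⟩
  have hcard := sixteen_mul_card_filter_Cset hg hχ
  rw [pow_eq_pow_mod _ GaussianInt.sqrtd_pow_four] at hneg
  constructor
  · intro hp8
    rw [show (p - 1) / 2 % 4 = 0 by lia, pow_zero] at hneg
    have h := congrArg Zsqrtd.re (hcard 1 2)
    rw [sum_jacobiSum_quartic hg hχ (by rw [hneg, one_pow]) (fun a => ((-sqrtd) ^ _) ^ a)
      (fun b => ((-sqrtd) ^ _) ^ b), hneg, show (1 : ZMod 4).val = 1 from rfl,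
      show (2 : ZMod 4).val = 2 from rfl] at h
    generalize jacobiSum χ (χ ^ 2) = J at h hnorm huniq
    simp [pow_succ] at h
    have := huniq (a := -J.re) (by rwa [neg_sq]) (by lia)
    lia
  · intro hp8
    rw [show (p - 1) / 2 % 4 = 2 by lia, GaussianInt.sqrtd_sq] at hneg
    have h := congrArg Zsqrtd.re (hcard 1 0)
    rw [sum_jacobiSum_quartic hg hχ (by rw [hneg, neg_one_sq]) (fun a => ((-sqrtd) ^ _) ^ a)
      (fun b => ((-sqrtd) ^ _) ^ b), hneg, show (1 : ZMod 4).val = 1 from rfl,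
      show (0 : ZMod 4).val = 0 from rfl] at h
    generalize jacobiSum χ (χ ^ 2) = J at h hnorm huniq
    simp [pow_succ] at h
    have := huniq hnorm (by lia)
    lia
end
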